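/- There exists a constant C > 0, independent of the initial measure m₀, of the horizon, and of δ, such that for any classical solution (u,m) of the discounted MFG system −∂ₜu − Δu + δu + H(x,Du) = F(x,m), −∂ₜm + Δm + div(m D_pH(x,Du)) = 0 on [0,∞)×𝕋^d with m(0) = m₀ and u bounded, one has: ‖Du‖_{L^∞([0,∞)×𝕋^d)} ≤ C; |D²u(s,·)| ≤ C for every s ∈ [0,∞); d(m(s),m(l)) ≤ C|l−s|^{1/2} for all l,s ∈ [0,∞); and consequently |∂ₜu(s,·)| ≤ C for every s ∈ [0,∞). -/

import Mathlib

/- Common framework for "On the long time convergence of potential MFG" (M. Masoero).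

We work on the flat torus `𝕋^d`, modeled as `Td d := Fin d → AddCircle 1`.
Smooth functions on the torus are represented by `ℤ^d`-periodic functions on
`Vd d := Fin d → ℝ`; a function on `Vd d` is transported to the torus through the
canonical (measurable) section `secT : Td d → Vd d`.  Probability measures on the
torus are `PTd d := ProbabilityMeasure (Td d)`, endowed with the 1-Wasserstein
distance `W1` defined through Kantorovich duality.  The Fokker--Planck equations
and their stationary analogues are stated in the sense of distributions, i.e.
against smooth periodic test functions; `σ` is the viscosity parameter
(everywhere `σ = 1` except in the non-convex example). -/

open MeasureTheory Real Set Filter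

noncomputable section

abbrev Vd (d : ℕ) : Type := Fin d → ℝ
abbrev Td (d : ℕ) : Type := Fin d → AddCircle (1 : ℝ)

instance factOneposR : Fact ((0:ℝ) < 1) := ⟨one_pos⟩

/-- The canonical measurable section of the torus, with values in `[0,1)^d`. -/
def secT {d : ℕ} (y : Td d) : Vd d := fun i => ((AddCircle.equivIco 1 0) (y i)).1

/-- The vector of `ℝ^d` associated with an integer vector. -/
def intVec {d : ℕ} (z : Fin d → ℤ) : Vd d := fun i => (z i : ℝ)

/-- Euclidean scalar product on `ℝ^d`. -/
def dotp {d : ℕ} (a b : Vd d) : ℝ := ∑ i, a i * b i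

/-- Squared euclidean norm on `ℝ^d`. -/
def sqnorm {d : ℕ} (a : Vd d) : ℝ := ∑ i, (a i)^2

/-- Spatial gradient. -/
def gradv {d : ℕ} (g : Vd d → ℝ) (x : Vd d) : Vd d := fun i => fderiv ℝ g x (Pi.single i 1)

/-- Second derivative of `g` at `x` in the directions `v, w`. -/
def D2 {d : ℕ} (g : Vd d → ℝ) (x v w : Vd d) : ℝ := fderiv ℝ (fun y => fderiv ℝ g y v) x w

/-- Laplacian. -/
def lapl {d : ℕ} (g : Vd d → ℝ) (x : Vd d) : ℝ := ∑ i, D2 g x (Pi.single i 1) (Pi.single i 1)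

/-- Divergence of a vector field. -/
def divv {d : ℕ} (b : Vd d → Vd d) (x : Vd d) : ℝ :=
  ∑ i, fderiv ℝ (fun y => b y i) x (Pi.single i 1)

/-- Time derivative of a time dependent function. -/
def tderiv {d : ℕ} (u : ℝ → Vd d → ℝ) (t : ℝ) (x : Vd d) : ℝ := deriv (fun s => u s x) t

abbrev PTd (d : ℕ) := ProbabilityMeasure (Td d)

/-- The 1-Wasserstein (Monge--Kantorovich) distance, via Kantorovich duality. -/
def W1 {d : ℕ} (μ ν : PTd d) : ℝ :=
  sSup { r | ∃ φ : Td d → ℝ, LipschitzWith 1 φ ∧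
    r = (∫ y, φ y ∂(μ : Measure (Td d))) - ∫ y, φ y ∂(ν : Measure (Td d)) }

/-- The convex combination `(1-t) μ + t ν`. -/
def lineComb {d : ℕ} (t : ℝ) (μ ν : PTd d) : Measure (Td d) :=
  ENNReal.ofReal (1 - t) • (μ : Measure (Td d)) + ENNReal.ofReal t • (ν : Measure (Td d))

/-- The standing assumptions of the paper: a Hamiltonian `H` (a `ℤ^d`-periodic function of
`(x,p)`), its convex conjugate `Hstar` in the `p` variable, a `C²` coupling function
`Fc` on `P(𝕋^d)` with flat derivative `Fd` (represented by periodic functions on `ℝ^d`),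
with the regularity and growth conditions of the paper. -/
structure MFGSetting (d : ℕ) where
  H : Vd d → Vd d → ℝ
  Hstar : Vd d → Vd d → ℝ
  Fc : PTd d → ℝ
  Fd : Measure (Td d) → Vd d → ℝ
  Cbar : ℝ
  Cbar_pos : 0 < Cbar
  θ : ℝ
  θ_mem : θ ∈ Set.Ioo (0:ℝ) 1
  Cg : ℝ
  Cg_pos : 0 < Cg
  CF : ℝ
  H_smooth : ContDiff ℝ 2 (fun q : Vd d × Vd d => H q.1 q.2)
  H_per : ∀ (x : Vd d) (z : Fin d → ℤ) (p : Vd d), H (x + intVec z) p = H x p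
  Dpp_lip : ∃ L : ℝ, 0 ≤ L ∧ ∀ (x p₁ p₂ v w : Vd d),
    |D2 (fun p => H x p) p₁ v w - D2 (fun p => H x p) p₂ v w| ≤ L * ‖p₁ - p₂‖ * ‖v‖ * ‖w‖
  Dpp_lower : ∀ x p v : Vd d, Cbar⁻¹ * sqnorm v ≤ D2 (fun p' => H x p') p v v
  Dpp_upper : ∀ x p v : Vd d, D2 (fun p' => H x p') p v v ≤ Cbar * sqnorm v
  Dxx_growth : ∀ x p v w : Vd d,
    |D2 (fun x' => H x' p) x v w| ≤ Cg * (1 + ‖p‖) ^ (1 + θ) * ‖v‖ * ‖w‖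
  Dxp_growth : ∀ x p v w : Vd d,
    |fderiv ℝ (fun x' => fderiv ℝ (fun p' => H x' p') p v) x w| ≤ Cg * (1 + ‖p‖) ^ θ * ‖v‖ * ‖w‖
  Hstar_eq : ∀ x q : Vd d, IsLUB (Set.range fun p => dotp q p - H x p) (Hstar x q)
  Fd_per : ∀ (μ : Measure (Td d)) (x : Vd d) (z : Fin d → ℤ), Fd μ (x + intVec z) = Fd μ x
  Fd_smooth : ∀ μ : Measure (Td d), IsProbabilityMeasure μ → ContDiff ℝ 2 (Fd μ)
  Fd_D2_bound : ∀ μ : Measure (Td d), IsProbabilityMeasure μ →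
    ∀ x v w : Vd d, |D2 (Fd μ) x v w| ≤ CF * ‖v‖ * ‖w‖
  flat_deriv : ∀ μ ν : PTd d,
    Fc ν - Fc μ = ∫ t in Set.Icc (0:ℝ) 1,
      ((∫ y, Fd (lineComb t μ ν) (secT y) ∂(ν : Measure (Td d))) -
        ∫ y, Fd (lineComb t μ ν) (secT y) ∂(μ : Measure (Td d)))
  Fd_normalized : ∀ μ : PTd d, (∫ y, Fd (μ : Measure (Td d)) (secT y) ∂(μ : Measure (Td d))) = 0
  Fc_bounded : ∃ M : ℝ, ∀ μ : PTd d, |Fc μ| ≤ M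
  Fd_bounded : ∃ M : ℝ, ∀ (μ : PTd d) (x : Vd d), |Fd (μ : Measure (Td d)) x| ≤ M

/-- Smooth periodic test functions on `[0,∞) × 𝕋^d` (resp. `ℝ × 𝕋^d`). -/
def IsTestFun {d : ℕ} (φ : ℝ → Vd d → ℝ) : Prop :=
  ContDiff ℝ 2 (fun q : ℝ × Vd d => φ q.1 q.2) ∧
  ∀ (t : ℝ) (x : Vd d) (z : Fin d → ℤ), φ t (x + intVec z) = φ t x

/-- The weak (distributional) formulation of the Fokker--Planck equation
`-∂ₜ m + σ Δ m + div(m α) = 0` between times `s₁` and `s₂`. -/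
def FPeq {d : ℕ} (σ : ℝ) (m : ℝ → PTd d) (α : ℝ → Td d → Vd d) (s₁ s₂ : ℝ) : Prop :=
  ∀ φ : ℝ → Vd d → ℝ, IsTestFun φ →
    (∫ y, φ s₂ (secT y) ∂(m s₂ : Measure (Td d))) -
      (∫ y, φ s₁ (secT y) ∂(m s₁ : Measure (Td d))) =
    ∫ s in s₁..s₂, ∫ y, (tderiv φ s (secT y) + σ * lapl (φ s) (secT y)
        - dotp (α s y) (gradv (φ s) (secT y))) ∂(m s : Measure (Td d))

/-- Continuity of a curve of measures with respect to the 1-Wasserstein distance. -/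
def W1ContOn {d : ℕ} (m : ℝ → PTd d) (I : Set ℝ) : Prop :=
  ∀ t ∈ I, ∀ ε > 0, ∃ η > 0, ∀ s ∈ I, |s - t| < η → W1 (m s) (m t) < ε

/-- Continuity of a function on `P(𝕋^d)` with respect to the 1-Wasserstein distance. -/
def W1Continuous {d : ℕ} (χ : PTd d → ℝ) : Prop :=
  ∀ μ : PTd d, ∀ ε > 0, ∃ η > 0, ∀ ν : PTd d, W1 μ ν < η → |χ ν - χ μ| < ε

/-- W1-closed subsets of `P(𝕋^d)`. -/
def IsClosedW1 {d : ℕ} (C : Set (PTd d)) : Prop :=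
  ∀ μ : PTd d, (∀ ε > 0, ∃ ν ∈ C, W1 μ ν < ε) → μ ∈ C

/-- The running cost `∫ H*(x,α(s)) dm(s) + 𝓕(m(s))`. -/
def runCost {d : ℕ} (S : MFGSetting d) (m : ℝ → PTd d) (α : ℝ → Td d → Vd d) (s : ℝ) : ℝ :=
  (∫ y, S.Hstar (secT y) (α s y) ∂(m s : Measure (Td d))) + S.Fc (m s)

/-- Admissible pairs `(m,α)` on `[0,T]` starting from `m₀` (with `α ∈ L²_m`). -/
def AdmOn {d : ℕ} (S : MFGSetting d) (σ : ℝ) (m₀ : PTd d) (T : ℝ)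
    (m : ℝ → PTd d) (α : ℝ → Td d → Vd d) : Prop :=
  m 0 = m₀ ∧ W1ContOn m (Set.Icc 0 T) ∧
  (∀ s₁ s₂ : ℝ, 0 ≤ s₁ → s₁ ≤ s₂ → s₂ ≤ T → FPeq σ m α s₁ s₂) ∧
  Measurable (fun q : ℝ × Td d => α q.1 q.2) ∧
  (∫⁻ s in Set.Ioc (0:ℝ) T, ∫⁻ y, ENNReal.ofReal (sqnorm (α s y)) ∂(m s : Measure (Td d))) < ⊤ ∧
  IntervalIntegrable (runCost S m α) volume 0 T

/-- Admissible pairs `(m,α)` on `[0,T]` starting from `m₀`, with `α` merely in `L¹_m`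
(the class `Π_T` used for problems with prescribed endpoints). -/
def AdmOn1 {d : ℕ} (S : MFGSetting d) (σ : ℝ) (m₀ : PTd d) (T : ℝ)
    (m : ℝ → PTd d) (α : ℝ → Td d → Vd d) : Prop :=
  m 0 = m₀ ∧ W1ContOn m (Set.Icc 0 T) ∧
  (∀ s₁ s₂ : ℝ, 0 ≤ s₁ → s₁ ≤ s₂ → s₂ ≤ T → FPeq σ m α s₁ s₂) ∧
  Measurable (fun q : ℝ × Td d => α q.1 q.2) ∧
  (∫⁻ s in Set.Ioc (0:ℝ) T, ∫⁻ y, ENNReal.ofReal (Real.sqrt (sqnorm (α s y)))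
      ∂(m s : Measure (Td d))) < ⊤ ∧
  IntervalIntegrable (runCost S m α) volume 0 T

/-- The finite horizon cost. -/
def costT {d : ℕ} (S : MFGSetting d) (m : ℝ → PTd d) (α : ℝ → Td d → Vd d) (T : ℝ) : ℝ :=
  ∫ s in (0:ℝ)..T, runCost S m α s

/-- The value `𝒰(T,m₀)` of the finite horizon problem. -/
def Ufun {d : ℕ} (S : MFGSetting d) (σ : ℝ) (T : ℝ) (m₀ : PTd d) : ℝ :=
  sInf { r | ∃ m α, AdmOn S σ m₀ T m α ∧ r = costT S m α T }

/-- Admissible pairs for the infinite horizon `δ`-discounted problem. -/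
def AdmDisc {d : ℕ} (S : MFGSetting d) (σ : ℝ) (δ : ℝ) (m₀ : PTd d)
    (m : ℝ → PTd d) (α : ℝ → Td d → Vd d) : Prop :=
  m 0 = m₀ ∧ W1ContOn m (Set.Ici 0) ∧
  (∀ s₁ s₂ : ℝ, 0 ≤ s₁ → s₁ ≤ s₂ → FPeq σ m α s₁ s₂) ∧
  Measurable (fun q : ℝ × Td d => α q.1 q.2) ∧
  (∫⁻ s in Set.Ioi (0:ℝ), ENNReal.ofReal (Real.exp (-δ * s)) *
      ∫⁻ y, ENNReal.ofReal (sqnorm (α s y)) ∂(m s : Measure (Td d))) < ⊤ ∧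
  Integrable (fun s => Real.exp (-δ * s) * runCost S m α s) (volume.restrict (Set.Ioi 0))

/-- The discounted cost. -/
def costDisc {d : ℕ} (S : MFGSetting d) (δ : ℝ) (m : ℝ → PTd d) (α : ℝ → Td d → Vd d) : ℝ :=
  ∫ s in Set.Ioi (0:ℝ), Real.exp (-δ * s) * runCost S m α s

/-- The value `𝒱_δ(m₀)` of the discounted problem. -/
def Vfun {d : ℕ} (S : MFGSetting d) (σ : ℝ) (δ : ℝ) (m₀ : PTd d) : ℝ :=
  sInf { r | ∃ m α, AdmDisc S σ δ m₀ m α ∧ r = costDisc S δ m α }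

/-- `D_p H (x, p)`. -/
def DpH {d : ℕ} (S : MFGSetting d) (x p : Vd d) : Vd d :=
  fun i => fderiv ℝ (fun p' => S.H x p') p (Pi.single i 1)

/-- `C^{1,2}` regularity on `I × 𝕋^d` of a (periodic) time-dependent function. -/
def Creg12 {d : ℕ} (u : ℝ → Vd d → ℝ) (I : Set ℝ) : Prop :=
  ContinuousOn (fun q : ℝ × Vd d => u q.1 q.2) (I ×ˢ Set.univ) ∧
  (∀ x : Vd d, ∀ t ∈ I, DifferentiableAt ℝ (fun s => u s x) t) ∧
  (∀ t ∈ I, ContDiff ℝ 2 (u t)) ∧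
  (∀ t ∈ I, ∀ (x : Vd d) (z : Fin d → ℤ), u t (x + intVec z) = u t x)

/-- `(u,m)` is a classical solution of the `δ`-discounted MFG system on `[0,∞) × 𝕋^d`:
`-∂ₜ u - Δ u + δ u + H(x,Du) = F(x,m)` and `-∂ₜ m + Δ m + div(m D_pH(x,Du)) = 0`. -/
def SolvesDiscMFG {d : ℕ} (S : MFGSetting d) (δ : ℝ) (u : ℝ → Vd d → ℝ) (m : ℝ → PTd d) : Prop :=
  Creg12 u (Set.Ici 0) ∧
  (∀ t ∈ Set.Ici (0:ℝ), ∀ x : Vd d,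
    - tderiv u t x - lapl (u t) x + δ * u t x + S.H x (gradv (u t) x)
      = S.Fd (m t : Measure (Td d)) x) ∧
  W1ContOn m (Set.Ici 0) ∧
  (∀ s₁ s₂ : ℝ, 0 ≤ s₁ → s₁ ≤ s₂ →
    FPeq 1 m (fun s y => DpH S (secT y) (gradv (u s) (secT y))) s₁ s₂)

/-- Admissible pairs for the stationary (ergodic) problem:
`σ Δ m + div(m α) = 0` in the sense of distributions and `α ∈ L²_m`. -/
def StatAdm {d : ℕ} (σ : ℝ) (m : PTd d) (α : Td d → Vd d) : Prop :=
  Measurable α ∧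
  (∫⁻ y, ENNReal.ofReal (sqnorm (α y)) ∂(m : Measure (Td d))) < ⊤ ∧
  ∀ g : Vd d → ℝ, ContDiff ℝ 2 g → (∀ (x : Vd d) (z : Fin d → ℤ), g (x + intVec z) = g x) →
    (∫ y, (σ * lapl g (secT y) - dotp (α y) (gradv g (secT y))) ∂(m : Measure (Td d))) = 0

/-- `ergInf S σ = -λ̄`, the value of the stationary minimization problem. -/
def ergInf {d : ℕ} (S : MFGSetting d) (σ : ℝ) : ℝ :=
  sInf { r | ∃ m α, StatAdm σ m α ∧
    r = (∫ y, S.Hstar (secT y) (α y) ∂(m : Measure (Td d))) + S.Fc m }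

/-- The set of values over which the dynamic programming principle for a corrector
`χ` takes its infimum. -/
def DPPval {d : ℕ} (S : MFGSetting d) (σ : ℝ) (χ : PTd d → ℝ) (lam t : ℝ) (m₀ : PTd d) :
    Set ℝ :=
  { r | ∃ m α, AdmOn S σ m₀ t m α ∧
      r = (∫ s in (0:ℝ)..t, runCost S m α s) + χ (m t) + lam * t }

/-- `χ` is a corrector function: it is continuous and satisfies the dynamic
programming principle with the critical value `λ`. -/
def IsCorrector {d : ℕ} (S : MFGSetting d) (σ : ℝ) (lam : ℝ) (χ : PTd d → ℝ) : Prop :=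
  W1Continuous χ ∧ ∀ (m₀ : PTd d) (t : ℝ), 0 < t → χ m₀ = sInf (DPPval S σ χ lam t m₀)

/-- `(m,α)` is a calibrated curve (defined on all of `ℝ`). -/
def IsCalibrated {d : ℕ} (S : MFGSetting d) (σ : ℝ) (lam : ℝ)
    (m : ℝ → PTd d) (α : ℝ → Td d → Vd d) : Prop :=
  W1ContOn m Set.univ ∧
  (∀ s₁ s₂ : ℝ, s₁ ≤ s₂ → FPeq σ m α s₁ s₂) ∧
  Measurable (fun q : ℝ × Td d => α q.1 q.2) ∧
  (∀ t₁ t₂ : ℝ, (∫⁻ s in Set.Ioc t₁ t₂,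
      ∫⁻ y, ENNReal.ofReal (sqnorm (α s y)) ∂(m s : Measure (Td d))) < ⊤) ∧
  (∀ t₁ t₂ : ℝ, IntervalIntegrable (runCost S m α) volume t₁ t₂) ∧
  ∃ χ : PTd d → ℝ, IsCorrector S σ lam χ ∧ ∀ t₁ t₂ : ℝ, t₁ < t₂ →
    χ (m t₁) = lam * (t₂ - t₁) + (∫ s in t₁..t₂, runCost S m α s) + χ (m t₂)

/-- The projected Mather set. -/
def MatherSet {d : ℕ} (S : MFGSetting d) (σ : ℝ) (lam : ℝ) : Set (PTd d) :=
  { μ | ∃ m α, IsCalibrated S σ lam m α ∧ m 0 = μ }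

/-- Invariant subsets of the projected Mather set. -/
def IsInvariantMFG {d : ℕ} (S : MFGSetting d) (σ : ℝ) (lam : ℝ) (C : Set (PTd d)) : Prop :=
  ∀ μ ∈ C, ∃ m α, IsCalibrated S σ lam m α ∧ m 0 = μ ∧ ∀ t : ℝ, m t ∈ C

/-- Minimal invariant subsets of the projected Mather set. -/
def IsMinimalInvariant {d : ℕ} (S : MFGSetting d) (σ : ℝ) (lam : ℝ) (N : Set (PTd d)) : Prop :=
  N.Nonempty ∧ N ⊆ MatherSet S σ lam ∧ IsClosedW1 N ∧ IsInvariantMFG S σ lam N ∧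
  ∀ C : Set (PTd d), C ⊆ N → C.Nonempty → IsClosedW1 C → IsInvariantMFG S σ lam C → C = N

/-- `δ 𝒱_δ → -λ` uniformly as `δ → 0⁺`. -/
def IsLimitValueV {d : ℕ} (S : MFGSetting d) (σ : ℝ) (lam : ℝ) : Prop :=
  ∀ ε > 0, ∃ δ₀ > 0, ∀ δ : ℝ, 0 < δ → δ ≤ δ₀ → ∀ μ : PTd d,
    |δ * Vfun S σ δ μ - (-lam)| < ε

/-- `𝒰(T,·)/T → -λ` uniformly as `T → ∞`. -/
def IsLimitValueU {d : ℕ} (S : MFGSetting d) (σ : ℝ) (lam : ℝ) : Prop :=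
  ∀ ε > 0, ∃ T₀ : ℝ, ∀ T : ℝ, T₀ ≤ T → ∀ μ : PTd d,
    |Ufun S σ T μ / T - (-lam)| < ε

/-- A function `Φ` on `P(𝕋^d)` is `C¹` with flat derivative `dΦ` (normalized so that
`∫ dΦ(m,·) dm = 0`, periodic in the space variable and jointly continuous). -/
def IsC1Flat {d : ℕ} (Φ : PTd d → ℝ) (dΦ : Measure (Td d) → Vd d → ℝ) : Prop :=
  (∀ (μ : Measure (Td d)) (x : Vd d) (z : Fin d → ℤ), dΦ μ (x + intVec z) = dΦ μ x) ∧
  (∀ μ ν : PTd d,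
    Φ ν - Φ μ = ∫ t in Set.Icc (0:ℝ) 1,
      ((∫ y, dΦ (lineComb t μ ν) (secT y) ∂(ν : Measure (Td d))) -
        ∫ y, dΦ (lineComb t μ ν) (secT y) ∂(μ : Measure (Td d)))) ∧
  (∀ μ : PTd d, (∫ y, dΦ (μ : Measure (Td d)) (secT y) ∂(μ : Measure (Td d))) = 0) ∧
  (∀ ε > 0, ∀ (μ : PTd d) (x : Vd d), ∃ η > 0, ∀ (ν : PTd d) (x' : Vd d),
    W1 μ ν < η → ‖x' - x‖ < η → |dΦ (ν : Measure (Td d)) x' - dΦ (μ : Measure (Td d)) x| < ε)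

open Topology

lemma ue_fderiv_dotp {d : ℕ} (g : Vd d → ℝ) (x v : Vd d) :
    fderiv ℝ g x v = dotp (gradv g x) v := by
  have := (fderiv ℝ g x).toLinearMap.pi_apply_eq_sum_univ v
  simp only [ContinuousLinearMap.coe_coe] at this
  rw [this, dotp]
  refine Finset.sum_congr rfl fun i _ => ?_
  rw [gradv, smul_eq_mul, mul_comm]
  congr 2
  ext j
  simp [Pi.single_apply, eq_comm]

lemma ue_sqnorm_nonneg {d : ℕ} (a : Vd d) : 0 ≤ sqnorm a :=
  Finset.sum_nonneg fun i _ => sq_nonneg _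

/-- Euclidean norm. -/
def ueNr {d : ℕ} (a : Vd d) : ℝ := Real.sqrt (sqnorm a)

lemma ueNr_nonneg {d : ℕ} (a : Vd d) : 0 ≤ ueNr a := Real.sqrt_nonneg _

lemma ueNr_sq {d : ℕ} (a : Vd d) : ueNr a ^ 2 = sqnorm a := Real.sq_sqrt (ue_sqnorm_nonneg a)

lemma ue_dotp_self {d : ℕ} (a : Vd d) : dotp a a = sqnorm a := by
  simp [dotp, sqnorm, sq]

lemma ue_dotp_le {d : ℕ} (a b : Vd d) : |dotp a b| ≤ ueNr a * ueNr b := by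
  apply abs_le_of_sq_le_sq _ (mul_nonneg (ueNr_nonneg _) (ueNr_nonneg _))
  rw [mul_pow, ueNr_sq, ueNr_sq]
  exact Finset.sum_mul_sq_le_sq_mul_sq _ _ _

lemma ue_norm_le_nr {d : ℕ} (a : Vd d) : ‖a‖ ≤ ueNr a := by
  rw [pi_norm_le_iff_of_nonneg (ueNr_nonneg a)]
  intro i
  rw [Real.norm_eq_abs]
  apply Real.abs_le_sqrt
  exact Finset.single_le_sum (f := fun i => (a i)^2) (fun i _ => sq_nonneg _) (Finset.mem_univ i)

lemma ue_sqnorm_le {d : ℕ} (a : Vd d) : sqnorm a ≤ d * ‖a‖ ^ 2 := by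
  have : sqnorm a ≤ ∑ _i : Fin d, ‖a‖ ^ 2 := by
    apply Finset.sum_le_sum
    intro i _
    rw [← sq_abs]
    have := norm_le_pi_norm a i
    rw [Real.norm_eq_abs] at this
    gcongr
  simpa using this

lemma ue_nr_le {d : ℕ} (a : Vd d) : ueNr a ≤ (d + 1) * ‖a‖ := by
  apply Real.sqrt_le_iff.2 ⟨by positivity, ?_⟩
  refine (ue_sqnorm_le a).trans ?_
  rw [mul_pow]
  have : (d:ℝ) ≤ (d+1)^2 := by nlinarith [(Nat.cast_nonneg d : (0:ℝ) ≤ d)]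
  gcongr

lemma ue_sqnorm_smul {d : ℕ} (c : ℝ) (a : Vd d) : sqnorm (c • a) = c ^ 2 * sqnorm a := by
  simp [sqnorm, mul_pow, Finset.mul_sum]

lemma ueNr_smul {d : ℕ} (c : ℝ) (a : Vd d) : ueNr (c • a) = |c| * ueNr a := by
  rw [ueNr, ue_sqnorm_smul, Real.sqrt_mul (sq_nonneg _), Real.sqrt_sq_eq_abs, ueNr]

lemma ue_nr_add {d : ℕ} (a b : Vd d) : ueNr (a + b) ≤ ueNr a + ueNr b := by
  have h : sqnorm (a + b) = sqnorm a + 2 * dotp a b + sqnorm b := by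
    simp only [sqnorm, dotp, Finset.mul_sum, ← Finset.sum_add_distrib]
    exact Finset.sum_congr rfl fun i _ => by simp only [Pi.add_apply]; ring
  apply Real.sqrt_le_iff.2 ⟨add_nonneg (ueNr_nonneg _) (ueNr_nonneg _), ?_⟩
  have := (abs_le.1 (ue_dotp_le a b)).2
  rw [h]
  nlinarith [ueNr_sq a, ueNr_sq b]

lemma ue_line {d : ℕ} {g : Vd d → ℝ} (hg : Differentiable ℝ g) (x a : Vd d) (τ : ℝ) :
    HasDerivAt (fun τ : ℝ => g (x + τ • a)) (fderiv ℝ g (x + τ • a) a) τ := by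
  have h1 : HasDerivAt (fun τ : ℝ => x + τ • a) a τ := by
    simpa using ((hasDerivAt_id τ).smul_const a).const_add x
  exact (hg (x + τ • a)).hasFDerivAt.comp_hasDerivAt τ h1

lemma ue_line0 {d : ℕ} {g : Vd d → ℝ} (hg : Differentiable ℝ g) (x a : Vd d) :
    HasDerivAt (fun τ : ℝ => g (x + τ • a)) (dotp (gradv g x) a) 0 := by
  have := ue_line hg x a 0
  rwa [zero_smul, add_zero, ue_fderiv_dotp] at this

lemma ue_diff2 {d : ℕ} {g : Vd d → ℝ} (hg : ContDiff ℝ 2 g) : Differentiable ℝ (fderiv ℝ g) :=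
  (hg.fderiv_right (m := 1) (by norm_num)).differentiable (by norm_num)

lemma ue_diff2' {d : ℕ} {g : Vd d → ℝ} (hg : ContDiff ℝ 2 g) (v : Vd d) :
    Differentiable ℝ (fun y => fderiv ℝ g y v) :=
  fun y => ((ue_diff2 hg) y).clm_apply (differentiableAt_const v)

lemma ue_D2_eq {d : ℕ} {g : Vd d → ℝ} (hg : ContDiff ℝ 2 g) (x v w : Vd d) :
    D2 g x v w = fderiv ℝ (fderiv ℝ g) x w v := by
  rw [D2]
  have h := ((ue_diff2 hg) x).hasFDerivAt.clm_apply (hasFDerivAt_const v x)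
  rw [h.fderiv]
  simp

lemma ue_D2_symm {d : ℕ} {g : Vd d → ℝ} (hg : ContDiff ℝ 2 g) (x v w : Vd d) :
    D2 g x v w = D2 g x w v := by
  rw [ue_D2_eq hg, ue_D2_eq hg]
  have : IsSymmSndFDerivAt ℝ g x := hg.contDiffAt.isSymmSndFDerivAt (by simp)
  exact this w v

lemma ue_sd1 {f f' : ℝ → ℝ} {c : ℝ} (hf : ∀ τ, HasDerivAt f (f' τ) τ) (hf' : HasDerivAt f' c 0) :
    Tendsto (fun τ : ℝ => (f τ + f (-τ) - 2 * f 0) / τ ^ 2) (𝓝[>] 0) (𝓝 c) := by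
  have hc : Continuous f := continuous_iff_continuousAt.2 fun x => (hf x).continuousAt
  have hneg : ∀ τ, HasDerivAt (fun τ => f (-τ)) (-f' (-τ)) τ := fun τ => by
    simpa [Function.comp_def] using (hf (-τ)).comp τ (hasDerivAt_neg τ)
  refine HasDerivAt.lhopital_zero_nhdsGT (f' := fun τ => f' τ - f' (-τ)) (g' := fun τ => 2 * τ)
    (Eventually.of_forall fun τ => ?_) (Eventually.of_forall fun τ => ?_) ?_ ?_ ?_ ?_
  · have := ((hf τ).add (hneg τ)).sub_const (2 * f 0)
    simpa [sub_eq_add_neg] using this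
  · simpa using hasDerivAt_pow 2 τ
  · filter_upwards [self_mem_nhdsWithin] with τ hτ
    have : (0:ℝ) < τ := hτ
    positivity
  · have : Continuous fun τ => f τ + f (-τ) - 2 * f 0 := by fun_prop
    have h := (this.tendsto 0).mono_left (nhdsWithin_le_nhds (s := Ioi 0))
    convert h using 2
    simp; ring
  · have : Continuous fun τ : ℝ => τ ^ 2 := by fun_prop
    have h := (this.tendsto 0).mono_left (nhdsWithin_le_nhds (s := Ioi 0))
    simpa using h
  · have h1 := hf'.tendsto_slope_zero_right
    have h2 := (show HasDerivAt (fun τ => f' (-τ)) (-c) 0 by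
      have := (show HasDerivAt f' c (-0) by simpa using hf').comp (0:ℝ) (hasDerivAt_neg 0)
      simpa [Function.comp_def] using this).tendsto_slope_zero_right
    have := (h1.sub h2).const_mul (1/2)
    have e : (1/2) * (c - -c) = c := by ring
    rw [e] at this
    refine this.congr' ?_
    filter_upwards [self_mem_nhdsWithin] with τ hτ
    have : τ ≠ 0 := ne_of_gt hτ
    simp only [zero_add, neg_zero, smul_eq_mul]
    field_simp
    ring

lemma ue_sd {d : ℕ} {g : Vd d → ℝ} (hg : ContDiff ℝ 2 g) (x a : Vd d) :
    Tendsto (fun τ : ℝ => (g (x + τ • a) + g (x + (-τ) • a) - 2 * g x) / τ ^ 2) (𝓝[>] 0)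
      (𝓝 (D2 g x a a)) := by
  have h := ue_sd1 (ue_line (hg.differentiable (by norm_num)) x a)
    (c := D2 g x a a) (by simpa [D2] using ue_line (ue_diff2' hg a) x a 0)
  simpa using h

/-- A limit along `0+` of a nonpositive quantity. -/
lemma ue_lim_le {f : ℝ → ℝ} {c : ℝ} (h : Tendsto f (𝓝[>] 0) (𝓝 c))
    (h' : ∀ᶠ τ in 𝓝[>] (0:ℝ), f τ ≤ 0) : c ≤ 0 := le_of_tendsto h h'

lemma ue_lapl_add {d : ℕ} {g : Vd d → ℝ} (hg : ContDiff ℝ 2 g) (x n : Vd d) (hn : sqnorm n = 1) :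
    ∑ i, D2 g x (Pi.single i 1 - (2 * n i) • n) (Pi.single i 1 - (2 * n i) • n) = lapl g x := by
  have hb : ∀ v, D2 g x n v = dotp (fun i => D2 g x n (Pi.single i 1)) v := by
    intro v
    exact ue_fderiv_dotp (fun y => fderiv ℝ g y n) x v
  have e : ∀ i, D2 g x (Pi.single i 1 - (2 * n i) • n) (Pi.single i 1 - (2 * n i) • n)
      = D2 g x (Pi.single i 1) (Pi.single i 1) - 4 * (D2 g x n (Pi.single i 1) * n i)
        + 4 * n i ^ 2 * D2 g x n n := by
    intro i
    have hs := ue_D2_symm hg x (Pi.single i 1) n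
    simp only [ue_D2_eq hg, map_sub, map_smul, _root_.sub_apply,
      _root_.smul_apply, smul_eq_mul] at hs ⊢
    rw [hs]; ring
  simp only [e, Finset.sum_add_distrib, Finset.sum_sub_distrib, ← Finset.mul_sum, ← Finset.sum_mul]
  have h1 : ∑ i, D2 g x n (Pi.single i 1) * n i = D2 g x n n := (hb n).symm
  have h2 : ∑ i, n i ^ 2 = 1 := hn
  rw [h1, h2, lapl]; ring

/-- Polarisation. -/
lemma ue_D2_polar {d : ℕ} {g : Vd d → ℝ} (hg : ContDiff ℝ 2 g) (x : Vd d) {K : ℝ}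
    (hK : ∀ v, |D2 g x v v| ≤ K * ‖v‖ ^ 2) (v w : Vd d) : |D2 g x v w| ≤ 2 * K * ‖v‖ * ‖w‖ := by
  have add4 : ∀ v w, 4 * D2 g x v w = D2 g x (v + w) (v + w) - D2 g x (v - w) (v - w) := by
    intro v w
    have hs := ue_D2_symm hg x v w
    simp only [ue_D2_eq hg, map_sub, map_add, _root_.sub_apply,
      _root_.add_apply] at hs ⊢
    rw [hs]; ring
  have key : ∀ v w, ‖v‖ = 1 → ‖w‖ = 1 → |D2 g x v w| ≤ 2 * K := by
    intro v w hv hw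
    have h1 := hK (v + w)
    have h2 := hK (v - w)
    have n1 : ‖v + w‖ ≤ 2 := by have := norm_add_le v w; linarith
    have n2 : ‖v - w‖ ≤ 2 := by have := norm_sub_le v w; linarith
    have K0 : 0 ≤ K := by
      have := (abs_nonneg _).trans (hK v)
      rw [hv] at this; linarith
    have s1 : ‖v + w‖ ^ 2 ≤ 4 := by nlinarith [norm_nonneg (v + w)]
    have s2 : ‖v - w‖ ^ 2 ≤ 4 := by nlinarith [norm_nonneg (v - w)]
    have := add4 v w
    rw [abs_le] at h1 h2 ⊢
    constructor <;> nlinarith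
  by_cases hv : v = 0
  · subst hv; simp [ue_D2_eq hg]
  by_cases hw : w = 0
  · subst hw; simp [ue_D2_eq hg]
  have nv : 0 < ‖v‖ := norm_pos_iff.2 hv
  have nw : 0 < ‖w‖ := norm_pos_iff.2 hw
  have := key (‖v‖⁻¹ • v) (‖w‖⁻¹ • w) (by rw [norm_smul]; simp [nv.ne']) (by rw [norm_smul]; simp [nw.ne'])
  simp only [ue_D2_eq hg, map_smul, _root_.smul_apply, smul_eq_mul] at this ⊢
  rw [abs_mul, abs_mul, abs_of_pos (inv_pos.2 nv), abs_of_pos (inv_pos.2 nw)] at this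
  have h3 := mul_le_mul_of_nonneg_left this (mul_pos nv nw).le
  calc _ = ‖v‖ * ‖w‖ * (‖w‖⁻¹ * (‖v‖⁻¹ * |fderiv ℝ (fderiv ℝ g) x w v|)) := by field_simp
    _ ≤ _ := by rw [mul_left_comm] at h3 ⊢; linarith

lemma ue_max {E : Type*} [NormedAddCommGroup E] [ProperSpace E] (f : ℝ → E → ℝ)
    (hc : ContinuousOn (fun q : ℝ × E => f q.1 q.2) (Ici 0 ×ˢ univ)) (R B : ℝ)
    (hR : ∀ t, 0 ≤ t → ∀ e, ∃ e', ‖e'‖ ≤ R ∧ f t e ≤ f t e')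
    (hB : ∀ t, 0 ≤ t → ∀ e, f t e ≤ B) (ε : ℝ) (hε : 0 < ε) :
    ∃ t₁, 0 ≤ t₁ ∧ ∃ e₁, ‖e₁‖ ≤ R ∧ ∀ t, 0 ≤ t → ∀ e, f t e - ε * t ≤ f t₁ e₁ - ε * t₁ := by
  obtain ⟨e0, he0, -⟩ := hR 0 le_rfl 0
  set T := (B - f 0 e0) / ε + 1 with hT
  have hT0 : 0 ≤ T := by
    have := hB 0 le_rfl e0
    have : 0 ≤ (B - f 0 e0) / ε := div_nonneg (by linarith) hε.le
    linarith
  have hcomp : IsCompact (Icc (0:ℝ) T ×ˢ Metric.closedBall (0:E) R) :=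
    isCompact_Icc.prod (isCompact_closedBall 0 R)
  have hcont : ContinuousOn (fun q : ℝ × E => f q.1 q.2 - ε * q.1)
      (Icc (0:ℝ) T ×ˢ Metric.closedBall (0:E) R) := by
    apply ContinuousOn.sub
    · exact hc.mono (prod_mono Icc_subset_Ici_self (subset_univ _))
    · fun_prop
  obtain ⟨⟨t1, e1⟩, ⟨ht1, he1⟩, hmax⟩ := hcomp.exists_isMaxOn
    ⟨(0, e0), ⟨⟨le_rfl, hT0⟩, by simpa using he0⟩⟩ hcont
  refine ⟨t1, ht1.1, e1, by simpa using he1, fun t ht e => ?_⟩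
  by_cases htT : t ≤ T
  · obtain ⟨e', he', hle⟩ := hR t ht e
    have := hmax (show ((t, e') : ℝ × E) ∈ _ from ⟨⟨ht, htT⟩, by simpa using he'⟩)
    simp only [mem_ofPred_eq] at this
    linarith
  · have h1 := hmax (show ((0, e0) : ℝ × E) ∈ _ from ⟨⟨le_rfl, hT0⟩, by simpa using he0⟩)
    simp only [mem_ofPred_eq] at h1
    have h2 := hB t ht e
    push Not at htT
    have h3 : ε * T ≤ ε * t := by gcongr
    have h4 : ε * T = B - f 0 e0 + ε := by rw [hT]; field_simp
    linarith

lemma ue_time {g : ℝ → ℝ} {c t₁ ε : ℝ} (hg : HasDerivAt g c t₁)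
    (h : ∀ t, t₁ ≤ t → g t - ε * t ≤ g t₁ - ε * t₁) : c ≤ ε := by
  have h1 := hg.tendsto_slope_zero_right
  refine le_of_tendsto h1 ?_
  filter_upwards [self_mem_nhdsWithin] with τ hτ
  have hτ' : (0:ℝ) < τ := hτ
  have := h (t₁ + τ) (by linarith)
  rw [smul_eq_mul, inv_mul_le_iff₀ hτ']
  linarith

lemma ue_crit {g : ℝ → ℝ} {c : ℝ} (hg : HasDerivAt g c 0) (h : ∀ t, g t ≤ g 0) : c = 0 :=
  IsLocalMax.hasDerivAt_eq_zero (Eventually.of_forall h) hg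

lemma ue_red {d : ℕ} (x : Vd d) : ∃ z : Fin d → ℤ, ‖x + intVec z‖ ≤ 1 := by
  refine ⟨fun i => -⌊x i⌋, ?_⟩
  rw [pi_norm_le_iff_of_nonneg zero_le_one]
  intro i
  have h1 := Int.floor_le (x i)
  have h2 := Int.lt_floor_add_one (x i)
  simp only [Pi.add_apply, intVec, Int.cast_neg, Real.norm_eq_abs, abs_le]
  constructor <;> linarith

lemma ue_red2 {d : ℕ} (a : Vd d) : ∃ z : Fin d → ℤ, ‖a - intVec z‖ ≤ 1 ∧
    ueNr (a - intVec z) ≤ ueNr a := by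
  refine ⟨fun i => round (a i), ?_, ?_⟩
  · rw [pi_norm_le_iff_of_nonneg zero_le_one]
    intro i
    have := abs_sub_round (a i)
    simp only [Pi.sub_apply, intVec, Real.norm_eq_abs]
    linarith
  · apply Real.sqrt_le_sqrt
    apply Finset.sum_le_sum
    intro i _
    rw [sq_le_sq]
    simpa [intVec] using round_le (a i) 0

lemma ue_taylor {E : Type*} [NormedAddCommGroup E] [NormedSpace ℝ E] {G : E → ℝ}
    (hG : ContDiff ℝ 2 G) {s : Set E} (hs : Convex ℝ s) {C : ℝ}
    (hC : ∀ x ∈ s, ‖fderiv ℝ (fderiv ℝ G) x‖ ≤ C) {a b : E} (ha : a ∈ s) (hb : b ∈ s) :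
    |G b - G a - fderiv ℝ G a (b - a)| ≤ C * ‖b - a‖ ^ 2 := by
  have hd : Differentiable ℝ G := hG.differentiable (by norm_num)
  have hd2 : Differentiable ℝ (fderiv ℝ G) :=
    (hG.fderiv_right (m := 1) (by norm_num)).differentiable (by norm_num)
  have C0 : 0 ≤ C := (norm_nonneg (fderiv ℝ (fderiv ℝ G) a)).trans (hC a ha)
  have hs' : Convex ℝ (s ∩ Metric.closedBall a ‖b - a‖) := hs.inter (convex_closedBall _ _)
  have h := hs'.norm_image_sub_le_of_norm_fderiv_le' (f := G) (φ := fderiv ℝ G a)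
    (C := C * ‖b - a‖) (x := a) (y := b) (fun x _ => hd x) (fun x hx => ?_)
    ⟨ha, by simp⟩ ⟨hb, by simp [dist_eq_norm]⟩
  · rw [Real.norm_eq_abs] at h
    refine h.trans (le_of_eq (by ring))
  · have h2 := hs.norm_image_sub_le_of_norm_fderiv_le (f := fderiv ℝ G) (C := C)
      (x := a) (y := x) (fun x _ => hd2 x) hC ha hx.1
    refine h2.trans ?_
    have : ‖x - a‖ ≤ ‖b - a‖ := by simpa [dist_eq_norm] using hx.2
    gcongr

/-- Periodic functions with bounded second derivative. -/
lemma ue_per_grad {d : ℕ} {f : Vd d → ℝ} (hf : ContDiff ℝ 2 f)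
    (hp : ∀ x (z : Fin d → ℤ), f (x + intVec z) = f x) {B : ℝ} (hB0 : 0 ≤ B)
    (hB : ∀ x v w, |D2 f x v w| ≤ B * ‖v‖ * ‖w‖) (x v : Vd d) :
    |fderiv ℝ f x v| ≤ d * B * ‖v‖ := by
  have hd : Differentiable ℝ f := hf.differentiable (by norm_num)
  have key : ∀ i : Fin d, |gradv f x i| ≤ B := by
    intro i
    set e : Vd d := Pi.single i 1 with he
    have hen : ‖e‖ = 1 := by rw [he, Pi.norm_single]; simp
    have hl := ue_line hd x e
    have hl2 : ∀ τ, HasDerivAt (fun τ : ℝ => fderiv ℝ f (x + τ • e) e) (D2 f (x + τ • e) e e) τ :=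
      fun τ => ue_line (ue_diff2' hf e) x e τ
    obtain ⟨ξ, hξ, hξ0⟩ := exists_hasDerivAt_eq_zero (f := fun τ : ℝ => f (x + τ • e)) (a := 0)
      (b := 1) (f' := fun τ => fderiv ℝ f (x + τ • e) e) zero_lt_one
      (fun τ _ => (hl τ).continuousAt.continuousWithinAt)
      (by
        have : e = intVec (Pi.single i 1) := by
          ext j; by_cases h : j = i
          · subst h; simp [he, intVec]
          · simp [he, intVec, h]
        simp only [zero_smul, add_zero, one_smul]
        rw [this, hp]) (fun τ _ => hl τ)
    have hc : Convex ℝ (univ : Set ℝ) := convex_univ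
    have h3 := hc.norm_image_sub_le_of_norm_hasDerivWithin_le
      (f := fun τ : ℝ => fderiv ℝ f (x + τ • e) e) (C := B) (x := ξ) (y := 0)
      (fun τ _ => (hl2 τ).hasDerivWithinAt)
      (fun τ _ => by simpa [hen] using hB (x + τ • e) e e) (mem_univ _) (mem_univ _)
    simp only [hξ0, zero_smul, add_zero, sub_zero, zero_sub, Real.norm_eq_abs, abs_neg] at h3
    refine h3.trans ?_
    rw [abs_of_pos hξ.1]
    nlinarith [hξ.2]
  rw [ue_fderiv_dotp, dotp]
  calc |∑ i, gradv f x i * v i| ≤ ∑ i, |gradv f x i * v i| := Finset.abs_sum_le_sum_abs _ _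
    _ ≤ ∑ _i : Fin d, B * ‖v‖ := by
      apply Finset.sum_le_sum
      intro i _
      rw [abs_mul]
      have := norm_le_pi_norm v i
      rw [Real.norm_eq_abs] at this
      gcongr
      exact key i
    _ = _ := by simp; ring

lemma ue_per_lip {d : ℕ} {f : Vd d → ℝ} (hf : ContDiff ℝ 2 f)
    (hp : ∀ x (z : Fin d → ℤ), f (x + intVec z) = f x) {B : ℝ} (hB0 : 0 ≤ B)
    (hB : ∀ x v w, |D2 f x v w| ≤ B * ‖v‖ * ‖w‖) (x y : Vd d) :
    |f x - f y| ≤ d * B * ‖x - y‖ := by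
  have hd : Differentiable ℝ f := hf.differentiable (by norm_num)
  have h := (convex_univ (𝕜 := ℝ) (E := Vd d)).norm_image_sub_le_of_norm_fderiv_le (f := f)
    (C := d * B) (x := y) (y := x) (fun x _ => hd x) (fun x _ => ?_) (mem_univ _) (mem_univ _)
  · simpa using h
  · apply ContinuousLinearMap.opNorm_le_bound _ (by positivity)
    intro v
    exact ue_per_grad hf hp hB0 hB x v

lemma ue_H_x {d : ℕ} (S : MFGSetting d) (p : Vd d) : ContDiff ℝ 2 (fun x => S.H x p) :=
  S.H_smooth.comp (contDiff_id.prodMk contDiff_const)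

lemma ue_H_p {d : ℕ} (S : MFGSetting d) (x : Vd d) : ContDiff ℝ 2 (fun p => S.H x p) :=
  S.H_smooth.comp (contDiff_const.prodMk contDiff_id)

lemma ue_H_lip {d : ℕ} (S : MFGSetting d) (p x y : Vd d) :
    |S.H x p - S.H y p| ≤ d * (S.Cg * (1 + ‖p‖) ^ (1 + S.θ)) * ‖x - y‖ := by
  have : 0 ≤ S.Cg * (1 + ‖p‖) ^ (1 + S.θ) := mul_nonneg S.Cg_pos.le (by positivity)
  exact ue_per_lip (ue_H_x S p) (fun x z => S.H_per x z p) this (fun x v w => S.Dxx_growth x p v w) x y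

lemma ue_H_mid {d : ℕ} (S : MFGSetting d) (y p : Vd d) :
    S.Cbar⁻¹ * sqnorm p / 4 ≤ S.H y p + S.H y 0 - 2 * S.H y ((1/2 : ℝ) • p) := by
  set c := S.Cbar⁻¹ * sqnorm p with hc
  have hH := ue_H_p S y
  have hl := ue_line (hH.differentiable (by norm_num)) 0 p
  have hl2 := fun τ => ue_line (ue_diff2' hH p) 0 p τ
  have h1 : ∀ τ, HasDerivAt (fun τ : ℝ => S.H y (0 + τ • p) - c / 2 * τ ^ 2)
      (fderiv ℝ (fun p => S.H y p) (0 + τ • p) p - c * τ) τ := by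
    intro τ
    have := (hl τ).sub ((hasDerivAt_pow 2 τ).const_mul (c/2))
    refine this.congr_deriv ?_
    push_cast; ring
  have h2 : ∀ τ, HasDerivAt (fun τ : ℝ => fderiv ℝ (fun p => S.H y p) (0 + τ • p) p - c * τ)
      (D2 (fun p => S.H y p) (0 + τ • p) p p - c) τ := by
    intro τ
    have := (hl2 τ).sub ((hasDerivAt_id τ).const_mul c)
    refine this.congr_deriv ?_
    rw [mul_one, D2]
  have hconv : ConvexOn ℝ univ (fun τ : ℝ => S.H y (0 + τ • p) - c / 2 * τ ^ 2) := by
    apply convexOn_univ_of_deriv2_nonneg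
    · exact fun τ => (h1 τ).differentiableAt
    · rw [show deriv (fun τ : ℝ => S.H y (0 + τ • p) - c / 2 * τ ^ 2) = _ from funext fun τ => (h1 τ).deriv]
      exact fun τ => (h2 τ).differentiableAt
    · intro τ
      rw [Function.iterate_succ, Function.iterate_one, Function.comp_apply,
        show deriv (fun τ : ℝ => S.H y (0 + τ • p) - c / 2 * τ ^ 2) = _ from funext fun τ => (h1 τ).deriv,
        (h2 τ).deriv]
      have := S.Dpp_lower y (0 + τ • p) p
      linarith
  have := hconv.2 (mem_univ 0) (mem_univ 1) (show (0:ℝ) ≤ 1/2 by norm_num)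
    (show (0:ℝ) ≤ 1/2 by norm_num) (by norm_num)
  simp only [smul_eq_mul, zero_smul, add_zero, mul_zero, mul_one, zero_add, one_smul] at this
  linarith

lemma ue_H_bdd {d : ℕ} (S : MFGSetting d) (P : ℝ) :
    ∃ C, 0 ≤ C ∧ ∀ x p, ‖p‖ ≤ P → |S.H x p| ≤ C := by
  have hcomp : IsCompact (Metric.closedBall (0 : Vd d) 1 ×ˢ Metric.closedBall (0 : Vd d) P) :=
    (isCompact_closedBall 0 1).prod (isCompact_closedBall 0 P)
  obtain ⟨C, hC⟩ := hcomp.exists_bound_of_continuousOn S.H_smooth.continuous.continuousOn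
  refine ⟨|C|, abs_nonneg _, fun x p hp => ?_⟩
  obtain ⟨z, hz⟩ := ue_red x
  rw [← S.H_per x z p]
  refine (hC (x + intVec z, p) ⟨by simpa using hz, by simpa using hp⟩).trans (le_abs_self _)

lemma ue_H_taylor {d : ℕ} (S : MFGSetting d) (P : ℝ) :
    ∃ C, 0 ≤ C ∧ ∀ x p, ‖p‖ ≤ P → ∃ l k : Vd d →L[ℝ] ℝ, (∀ h, |l h| ≤ C * ‖h‖) ∧
      ∀ h q, ‖h‖ ≤ 1 → ‖p + q‖ ≤ P →
        |S.H (x + h) (p + q) - S.H x p - k q - l h| ≤ C * (‖h‖ ^ 2 + ‖q‖ ^ 2) := by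
  set G := fun q : Vd d × Vd d => S.H q.1 q.2 with hG
  set s := Metric.closedBall (0 : Vd d) 2 ×ˢ Metric.closedBall (0 : Vd d) P
  have hcomp : IsCompact s := (isCompact_closedBall 0 2).prod (isCompact_closedBall 0 P)
  have hconv : Convex ℝ s := (convex_closedBall 0 2).prod (convex_closedBall 0 P)
  have hd1 : ContDiff ℝ 1 (fderiv ℝ G) := S.H_smooth.fderiv_right (m := 1) (by norm_num)
  obtain ⟨C1, hC1⟩ := hcomp.exists_bound_of_continuousOn
    (hd1.continuous_fderiv (by norm_num)).continuousOn
  obtain ⟨C2, hC2⟩ := hcomp.exists_bound_of_continuousOn hd1.continuous.continuousOn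
  refine ⟨max |C1| |C2|, (abs_nonneg C1).trans (le_max_left _ _), fun x p hp => ?_⟩
  obtain ⟨z, hz⟩ := ue_red x
  set X := x + intVec z with hX
  have hXs : (X, p) ∈ s := ⟨by simpa using hz.trans (by norm_num), by simpa using hp⟩
  refine ⟨(fderiv ℝ G (X, p)).comp (ContinuousLinearMap.inl ℝ _ _),
    (fderiv ℝ G (X, p)).comp (ContinuousLinearMap.inr ℝ _ _), fun h => ?_, fun h q hh hq => ?_⟩
  · have h1 := (fderiv ℝ G (X, p)).le_opNorm (h, 0)
    simp only [ContinuousLinearMap.comp_apply, ContinuousLinearMap.inl_apply]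
    rw [Real.norm_eq_abs] at h1
    refine h1.trans ?_
    rw [Prod.norm_mk, norm_zero, max_eq_left (norm_nonneg h)]
    gcongr
    exact (hC2 _ hXs).trans ((le_abs_self _).trans (le_max_right _ _))
  · have hb : (X + h, p + q) ∈ s := by
      refine ⟨?_, by simpa using hq⟩
      have := norm_add_le X h
      rw [mem_closedBall_zero_iff]
      linarith
    have h1 := ue_taylor S.H_smooth hconv hC1 hXs hb
    have e1 : ((X + h, p + q) : Vd d × Vd d) - (X, p) = (h, 0) + (0, q) := by simp
    have e2 : S.H (x + h) (p + q) = G (X + h, p + q) := by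
      simp only [hG, hX]
      rw [show x + intVec z + h = (x + h) + intVec z by abel, S.H_per]
    have e3 : S.H x p = G (X, p) := by
      simp only [hG, hX]; rw [S.H_per]
    have n1 : ‖((h, 0) + (0, q) : Vd d × Vd d)‖ ^ 2 ≤ ‖h‖ ^ 2 + ‖q‖ ^ 2 := by
      simp only [Prod.mk_add_mk, add_zero, zero_add, Prod.norm_mk]
      rcases max_cases ‖h‖ ‖q‖ with ⟨hm, -⟩ | ⟨hm, -⟩ <;> rw [hm] <;> nlinarith [sq_nonneg ‖h‖, sq_nonneg ‖q‖]
    rw [e1, map_add] at h1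
    rw [e2, e3]
    simp only [ContinuousLinearMap.comp_apply, ContinuousLinearMap.inl_apply,
      ContinuousLinearMap.inr_apply]
    calc _ = |G (X + h, p + q) - G (X, p) - ((fderiv ℝ G (X, p)) (h, 0) + (fderiv ℝ G (X, p)) (0, q))| := by
          congr 1; ring
      _ ≤ _ := h1
      _ ≤ C1 * (‖h‖ ^ 2 + ‖q‖ ^ 2) := by
          have : 0 ≤ C1 := (norm_nonneg _).trans (hC1 _ hXs)
          gcongr
      _ ≤ _ := by
          gcongr
          exact (le_abs_self _).trans (le_max_left _ _)

lemma ue_F_bd {d : ℕ} (S : MFGSetting d) (μ : PTd d) (x v w : Vd d) :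
    |D2 (S.Fd (μ : Measure (Td d))) x v w| ≤ |S.CF| * ‖v‖ * ‖w‖ := by
  refine (S.Fd_D2_bound _ inferInstance x v w).trans ?_
  gcongr
  exact le_abs_self _

lemma ue_F_taylor {d : ℕ} (S : MFGSetting d) (μ : PTd d) (x : Vd d) : 
    ∃ l : Vd d →L[ℝ] ℝ, (∀ h, |l h| ≤ d * |S.CF| * ‖h‖) ∧
      ∀ h, |S.Fd (μ : Measure (Td d)) (x + h) - S.Fd (μ : Measure (Td d)) x - l h| ≤ |S.CF| * ‖h‖ ^ 2 := by
  have hF := S.Fd_smooth (μ : Measure (Td d)) inferInstance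
  refine ⟨fderiv ℝ (S.Fd (μ : Measure (Td d))) x, fun h =>
    ue_per_grad hF (S.Fd_per _) (abs_nonneg _) (ue_F_bd S μ) x h, fun h => ?_⟩
  have := ue_taylor hF convex_univ (C := |S.CF|) (a := x) (b := x + h) (fun y _ => ?_)
    (mem_univ _) (mem_univ _)
  · simpa using this
  · apply ContinuousLinearMap.opNorm_le_bound _ (abs_nonneg _)
    intro w
    apply ContinuousLinearMap.opNorm_le_bound _ (by positivity)
    intro v
    rw [← ue_D2_eq hF, Real.norm_eq_abs]
    refine (ue_F_bd S μ y v w).trans (le_of_eq (by ring))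

lemma ue_growth {θ : ℝ} (hθ : θ ∈ Ioo (0:ℝ) 1) (A : ℝ) (hA : 0 ≤ A) :
    ∃ L₀, 1 ≤ L₀ ∧ ∀ L, L₀ ≤ L → A * (1 + L) ^ (1 + θ) + A < L ^ 2 := by
  have h1 : Tendsto (fun L : ℝ => L ^ (1 - θ)) atTop atTop := tendsto_rpow_atTop (by linarith [hθ.2])
  obtain ⟨L1, hL1⟩ := (h1.eventually_gt_atTop (8 * A + 1)).exists_forall_of_atTop
  refine ⟨max 1 L1, le_max_left _ _, fun L hL => ?_⟩
  have hL1' : 1 ≤ L := (le_max_left _ _).trans hL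
  have h2 := hL1 L ((le_max_right _ _).trans hL)
  have hpos : 0 < L := by linarith
  have h3 : (1 + L) ^ (1 + θ) ≤ 4 * L ^ (1 + θ) := by
    calc (1 + L) ^ (1 + θ) ≤ (2 * L) ^ (1 + θ) := by
          apply Real.rpow_le_rpow (by linarith) (by linarith) (by linarith [hθ.1])
      _ = 2 ^ (1 + θ) * L ^ (1 + θ) := Real.mul_rpow (by norm_num) hpos.le
      _ ≤ 2 ^ (2:ℝ) * L ^ (1 + θ) := by
          gcongr
          · norm_num
          · linarith [hθ.2]
      _ = 4 * L ^ (1 + θ) := by norm_num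
  have h4 : L ^ 2 = L ^ (1 - θ) * L ^ (1 + θ) := by
    rw [← Real.rpow_add hpos, ← Real.rpow_natCast]; congr 1; norm_num
  have h5 : 1 ≤ L ^ (1 + θ) := Real.one_le_rpow hL1' (by linarith [hθ.1])
  rw [h4]
  nlinarith

lemma ue_dotp_single {d : ℕ} (a : Vd d) (i : Fin d) : dotp a (Pi.single i 1) = a i := by
  simp [dotp, Pi.single_apply]

lemma ueNr_neg {d : ℕ} (a : Vd d) : ueNr (-a) = ueNr a := by
  simp [ueNr, sqnorm]

lemma ueNr_line {d : ℕ} (a b : Vd d) (ha : 0 < ueNr a) :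
    HasDerivAt (fun τ : ℝ => ueNr (a + τ • b)) (dotp a b / ueNr a) 0 := by
  have h1 : (fun τ : ℝ => ueNr (a + τ • b)) =
      fun τ : ℝ => Real.sqrt (sqnorm a + 2 * dotp a b * τ + sqnorm b * τ ^ 2) := by
    ext τ
    rw [ueNr]
    congr 1
    simp only [sqnorm, dotp, Finset.mul_sum, Finset.sum_mul, ← Finset.sum_add_distrib]
    exact Finset.sum_congr rfl fun i _ => by simp only [Pi.add_apply, Pi.smul_apply, smul_eq_mul]; ring
  rw [h1]
  have h0 : sqnorm a ≠ 0 := by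
    rw [← ueNr_sq]; positivity
  have h2 : HasDerivAt (fun τ : ℝ => sqnorm a + 2 * dotp a b * τ + sqnorm b * τ ^ 2)
      (2 * dotp a b) 0 := by
    have := (((hasDerivAt_id (0:ℝ)).const_mul (2 * dotp a b)).const_add (sqnorm a)).add
      ((hasDerivAt_pow 2 (0:ℝ)).const_mul (sqnorm b))
    refine this.congr_deriv ?_
    simp
  have h3 := h2.sqrt (by simpa using h0)
  refine h3.congr_deriv ?_
  simp only [mul_zero, add_zero, ne_eq, OfNat.ofNat_ne_zero, not_false_eq_true, zero_pow]
  rw [ueNr]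
  field_simp

lemma ueNr_pos {d : ℕ} {a : Vd d} (h : ueNr a ≠ 0) : 0 < ueNr a :=
  lt_of_le_of_ne (ueNr_nonneg a) (Ne.symm h)

lemma ueNr_eq_zero {d : ℕ} {a : Vd d} (h : ueNr a = 0) : a = 0 := by
  have := ue_norm_le_nr a
  rw [h] at this
  exact norm_le_zero_iff.1 this

lemma ueNr_continuous {d : ℕ} : Continuous (ueNr : Vd d → ℝ) := by
  unfold ueNr sqnorm
  fun_prop

lemma ue_intVec_add {d : ℕ} (z w : Fin d → ℤ) : intVec z + intVec w = intVec (z + w) := by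
  ext i; simp [intVec]

lemma ue_red_pair {d : ℕ} (x y : Vd d) : ∃ z₁ z₂ : Fin d → ℤ, ‖x + intVec z₁‖ ≤ 1 ∧
    ‖y + intVec z₂‖ ≤ 2 ∧ ueNr ((x + intVec z₁) - (y + intVec z₂)) ≤ ueNr (x - y) := by
  obtain ⟨z1, h1⟩ := ue_red x
  obtain ⟨z2, h2, h3⟩ := ue_red2 (x - y)
  refine ⟨z1, z2 + z1, h1, ?_, ?_⟩
  · rw [← ue_intVec_add]
    have : y + (intVec z2 + intVec z1) = (x + intVec z1) - (x - y - intVec z2) := by abel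
    rw [this]
    have := norm_sub_le (x + intVec z1) (x - y - intVec z2)
    linarith
  · rw [← ue_intVec_add]
    have : (x + intVec z1) - (y + (intVec z2 + intVec z1)) = x - y - intVec z2 := by abel
    rw [this]; exact h3

/-- The facts about a solution used in the estimates. -/
structure UeSol {d : ℕ} (S : MFGSetting d) (δ : ℝ) (u : ℝ → Vd d → ℝ) (m : ℝ → PTd d) : Prop where
  pos : 0 < δ
  cont : ContinuousOn (fun q : ℝ × Vd d => u q.1 q.2) (Ici 0 ×ˢ univ)
  sm : ∀ t, 0 ≤ t → ContDiff ℝ 2 (u t)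
  per : ∀ t, 0 ≤ t → ∀ x (z : Fin d → ℤ), u t (x + intVec z) = u t x
  dt : ∀ t, 0 ≤ t → ∀ x, HasDerivAt (fun s => u s x) (tderiv u t x) t
  eqn : ∀ t, 0 ≤ t → ∀ x, tderiv u t x + lapl (u t) x =
    δ * u t x + S.H x (gradv (u t) x) - S.Fd (m t : Measure (Td d)) x
  bdd : ∃ M : ℝ, ∀ t, 0 ≤ t → ∀ x : Vd d, |u t x| ≤ M

lemma ue_sol {d : ℕ} {S : MFGSetting d} {δ : ℝ} {u : ℝ → Vd d → ℝ} {m : ℝ → PTd d} (hδ : 0 < δ)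
    (h : SolvesDiscMFG S δ u m)
    (hb : ∃ M : ℝ, ∀ t ∈ Set.Ici (0:ℝ), ∀ x : Vd d, |u t x| ≤ M) : UeSol S δ u m where
  pos := hδ
  cont := h.1.1
  sm := fun t ht => h.1.2.2.1 t ht
  per := fun t ht => h.1.2.2.2 t ht
  dt := fun t ht x => (h.1.2.1 x t ht).hasDerivAt
  eqn := fun t ht x => by have := h.2.1 t ht x; linarith
  bdd := hb

lemma UeSol.contE {d : ℕ} {S : MFGSetting d} {δ : ℝ} {u : ℝ → Vd d → ℝ} {m : ℝ → PTd d}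
    (h : UeSol S δ u m) {E : Type*} [TopologicalSpace E] {pr : E → Vd d} (hpr : Continuous pr) :
    ContinuousOn (fun q : ℝ × E => u q.1 (pr q.2)) (Ici 0 ×ˢ univ) := by
  have h2 : ContinuousOn (fun q : ℝ × E => ((q.1, pr q.2) : ℝ × Vd d)) (Ici 0 ×ˢ univ) := by
    fun_prop
  exact h.cont.comp h2 (fun q hq => ⟨hq.1, mem_univ _⟩)

lemma UeSol.diff {d : ℕ} {S : MFGSetting d} {δ : ℝ} {u : ℝ → Vd d → ℝ} {m : ℝ → PTd d}
    (h : UeSol S δ u m) {t : ℝ} (ht : 0 ≤ t) : Differentiable ℝ (u t) :=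
  (h.sm t ht).differentiable (by norm_num)

/-- Step 0: `δ |u|` is bounded. -/
lemma ue_step0 {d : ℕ} (S : MFGSetting d) : ∃ A, 0 ≤ A ∧ ∀ δ u m, UeSol S δ u m →
    ∀ t, 0 ≤ t → ∀ x, |δ * u t x| ≤ A := by
  obtain ⟨C0, hC0, hH0⟩ := ue_H_bdd S 0
  obtain ⟨MF, hMF⟩ := S.Fd_bounded
  refine ⟨C0 + |MF|, by positivity, fun δ u m h => ?_⟩
  obtain ⟨M, hM⟩ := h.bdd
  have key : ∀ s : ℝ, |s| = 1 → ∀ t, 0 ≤ t → ∀ x, ∀ ε, 0 < ε →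
      s * (δ * u t x) ≤ C0 + |MF| + ε * (1 + δ * t) := by
    intro s hs t ht x ε hε
    obtain ⟨t1, ht1, x1, -, hmax⟩ := ue_max (E := Vd d) (fun t x => s * u t x)
      (continuousOn_const.mul (h.contE continuous_id)) 1 M
      (fun t ht x => by
        obtain ⟨z, hz⟩ := ue_red x
        exact ⟨_, hz, by rw [h.per t ht]⟩)
      (fun t ht x => by
        have := le_abs_self (s * u t x)
        rw [abs_mul, hs, one_mul] at this
        exact this.trans (hM t ht x)) ε hε
    have hs0 : s ≠ 0 := by rintro rfl; simp at hs
    have htime : s * tderiv u t1 x1 ≤ ε :=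
      ue_time (g := fun t => s * u t x1) ((h.dt t1 ht1 x1).const_mul s)
        (fun t ht => hmax t (ht1.trans ht) x1)
    have hgrad : gradv (u t1) x1 = 0 := by
      ext i
      have h1 := (ue_line0 (h.diff ht1) x1 (Pi.single i 1)).const_mul s
      have := ue_crit h1 (fun τ => by
        have := hmax t1 ht1 (x1 + τ • Pi.single i 1)
        simp only [zero_smul, add_zero]
        linarith)
      rw [ue_dotp_single] at this
      simpa [hs0] using this
    have hlap : s * lapl (u t1) x1 ≤ 0 := by
      rw [lapl, Finset.mul_sum]
      apply Finset.sum_nonpos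
      intro i _
      refine ue_lim_le ((ue_sd (h.sm t1 ht1) x1 (Pi.single i 1)).const_mul s) ?_
      filter_upwards with τ
      have a1 := hmax t1 ht1 (x1 + τ • Pi.single i 1)
      have a2 := hmax t1 ht1 (x1 + (-τ) • Pi.single i 1)
      rw [← mul_div_assoc]
      apply div_nonpos_of_nonpos_of_nonneg _ (sq_nonneg _)
      linarith
    have e := h.eqn t1 ht1 x1
    rw [hgrad] at e
    have b1 : |s * (S.H x1 0 - S.Fd (m t1 : Measure (Td d)) x1)| ≤ C0 + |MF| := by
      rw [abs_mul, hs, one_mul]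
      refine (abs_sub _ _).trans (add_le_add (hH0 x1 0 (by simp)) ((hMF _ _).trans (le_abs_self _)))
    have b2 := (abs_le.1 b1).1
    have b3 : s * (δ * u t1 x1) ≤ C0 + |MF| + ε := by
      have : s * (δ * u t1 x1) = s * tderiv u t1 x1 + s * lapl (u t1) x1
        - s * (S.H x1 0 - S.Fd (m t1 : Measure (Td d)) x1) := by
        rw [← mul_add, e]; ring
      linarith
    have b4 := hmax t ht x
    have b5 : δ * (s * u t x - ε * t) ≤ δ * (s * u t1 x1 - ε * t1) :=
      mul_le_mul_of_nonneg_left b4 h.pos.le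
    have b6 : 0 ≤ δ * (ε * t1) := mul_nonneg h.pos.le (mul_nonneg hε.le ht1)
    nlinarith
  have key2 : ∀ s : ℝ, |s| = 1 → ∀ t, 0 ≤ t → ∀ x, s * (δ * u t x) ≤ C0 + |MF| := by
    intro s hs t ht x
    have hp : 0 < 1 + δ * t := by have := mul_nonneg h.pos.le ht; linarith
    apply le_of_forall_pos_le_add
    intro η hη
    have := key s hs t ht x (η / (1 + δ * t)) (by positivity)
    rwa [div_mul_cancel₀ _ hp.ne'] at this
  intro t ht x
  rw [abs_le]
  have k1 := key2 1 (by simp) t ht x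
  have k2 := key2 (-1) (by simp) t ht x
  constructor <;> linarith

/-- Step 1: oscillation bound. -/
lemma ue_step1 {d : ℕ} (S : MFGSetting d) : ∃ O, 1 ≤ O ∧ ∀ δ u m, UeSol S δ u m →
    ∀ t, 0 ≤ t → ∀ x y, u t x - u t y ≤ O := by
  obtain ⟨C0, hC0, hH0⟩ := ue_H_bdd S 0
  obtain ⟨MF, hMF⟩ := S.Fd_bounded
  have hCb := S.Cbar_pos
  have hCg := S.Cg_pos
  set A := 4 * S.Cbar * (4 * d * S.Cg + 2 * C0 + 4 * |MF| + 1) with hA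
  have hA0 : 0 ≤ A := by positivity
  obtain ⟨L, hL1, hL⟩ := ue_growth S.θ_mem A hA0
  have hL := hL L le_rfl
  refine ⟨8 * L * (d + 1), by nlinarith [(Nat.cast_nonneg d : (0:ℝ) ≤ d)], fun δ u m h => ?_⟩
  obtain ⟨M, hM⟩ := h.bdd
  by_contra hcon
  push Not at hcon
  obtain ⟨t', ht', x', y', hxy'⟩ := hcon
  set W := {r | ∃ t, 0 ≤ t ∧ ∃ x y, r = u t x - u t y} with hW
  have hWb : BddAbove W := by
    refine ⟨2 * M, ?_⟩
    rintro r ⟨t, ht, x, y, rfl⟩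
    have h1 := abs_le.1 (hM t ht x)
    have h2 := abs_le.1 (hM t ht y)
    linarith
  set O := sSup W with hO
  have hOle : ∀ t, 0 ≤ t → ∀ x y, u t x - u t y ≤ O := fun t ht x y =>
    le_csSup hWb ⟨t, ht, x, y, rfl⟩
  have hO' : 8 * L * (d + 1) < O := hxy'.trans_le (hOle t' ht' x' y')
  have hOpos : 0 < O := lt_trans (by positivity) hO'
  obtain ⟨_, ⟨t0, ht0, x0, y0, rfl⟩, h0⟩ := exists_lt_of_lt_csSup
    (s := W) (b := 3/4 * O) ⟨_, t', ht', x', y', rfl⟩ (by rw [← hO]; linarith)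
  -- reduce `y0`
  obtain ⟨z1, z2, hx0, hy0, -⟩ := ue_red_pair x0 y0
  rw [← h.per t0 ht0 x0 z1, ← h.per t0 ht0 y0 z2] at h0
  set X0 := x0 + intVec z1
  set Y0 := y0 + intVec z2
  have hdist : ueNr (X0 - Y0) ≤ 3 * (d + 1) := by
    refine (ue_nr_le _).trans ?_
    have := norm_sub_le X0 Y0
    nlinarith [(Nat.cast_nonneg d : (0:ℝ) ≤ d)]
  set ε := min 1 (O / (16 * (t0 + 1))) with hε
  have hεpos : 0 < ε := lt_min one_pos (by positivity)
  have hε1 : ε ≤ 1 := min_le_left _ _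
  have hε2 : ε * t0 ≤ O / 16 := by
    have : ε ≤ O / (16 * (t0 + 1)) := min_le_right _ _
    calc ε * t0 ≤ ε * (t0 + 1) := by nlinarith
      _ ≤ O / (16 * (t0 + 1)) * (t0 + 1) := by gcongr
      _ = O / 16 := by field_simp
  obtain ⟨t, ht, ⟨x, y, z⟩, hnorm, hmax⟩ := ue_max (E := Vd d × Vd d × Vd d)
    (fun t e => u t e.1 + u t e.2.2 - 2 * u t e.2.1 - L * ueNr (e.1 - e.2.1))
    (by
      refine ContinuousOn.sub (ContinuousOn.sub (ContinuousOn.add ?_ ?_) (continuousOn_const.mul ?_)) ?_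
      · exact h.contE continuous_fst
      · exact h.contE (by fun_prop : Continuous fun e : Vd d × Vd d × Vd d => e.2.2)
      · exact h.contE (by fun_prop : Continuous fun e : Vd d × Vd d × Vd d => e.2.1)
      · have := ueNr_continuous (d := d)
        fun_prop) 2 (4 * M)
    (fun t ht e => by
      obtain ⟨z1, z2, h1, h2, h3⟩ := ue_red_pair e.1 e.2.1
      obtain ⟨z3, h4⟩ := ue_red e.2.2
      refine ⟨(e.1 + intVec z1, e.2.1 + intVec z2, e.2.2 + intVec z3), ?_, ?_⟩
      · simp only [Prod.norm_mk, max_le_iff]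
        exact ⟨by linarith, by linarith, by linarith⟩
      · simp only [h.per t ht]
        have := mul_le_mul_of_nonneg_left h3 (by linarith : 0 ≤ L)
        linarith)
    (fun t ht e => by
      have h1 := abs_le.1 (hM t ht e.1)
      have h2 := abs_le.1 (hM t ht e.2.1)
      have h3 := abs_le.1 (hM t ht e.2.2)
      have h4 := mul_nonneg (by linarith : 0 ≤ L) (ueNr_nonneg (e.1 - e.2.1))
      linarith) ε hεpos
  simp only [Prod.norm_mk, max_le_iff] at hnorm
  obtain ⟨nx, ny, nz⟩ := hnorm
  have hm : ∀ s, 0 ≤ s → ∀ a b c : Vd d, u s a + u s c - 2 * u s b - L * ueNr (a - b) - ε * s ≤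
    u t x + u t z - 2 * u t y - L * ueNr (x - y) - ε * t := fun s hs a b c => hmax s hs (a, b, c)
  have hval : O < u t x + u t z - 2 * u t y - L * ueNr (x - y) := by
    have h1 := hm t0 ht0 X0 Y0 X0
    have h2 : 0 ≤ ε * t := by positivity
    have h3 : L * ueNr (X0 - Y0) ≤ L * (3 * (d + 1)) := by gcongr
    nlinarith
  have hr : 0 < ueNr (x - y) := by
    apply ueNr_pos
    intro h0
    have : x = y := sub_eq_zero.1 (ueNr_eq_zero h0)
    rw [h0, this] at hval
    have := hOle t ht z y
    linarith
  set r := ueNr (x - y) with hrdef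
  have htime : tderiv u t x + tderiv u t z - 2 * tderiv u t y ≤ ε := by
    refine ue_time (g := fun s => u s x + u s z - 2 * u s y)
      (((h.dt t ht x).add (h.dt t ht z)).sub ((h.dt t ht y).const_mul 2)) (fun s hs => ?_)
    have := hm s (ht.trans hs) x y z
    linarith
  have hlap : lapl (u t) x + lapl (u t) z - 2 * lapl (u t) y ≤ 0 := by
    rw [lapl, lapl, lapl, Finset.mul_sum, ← Finset.sum_add_distrib, ← Finset.sum_sub_distrib]
    apply Finset.sum_nonpos
    intro i _
    set e : Vd d := Pi.single i 1
    refine ue_lim_le (((ue_sd (h.sm t ht) x e).add (ue_sd (h.sm t ht) z e)).sub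
      ((ue_sd (h.sm t ht) y e).const_mul 2)) ?_
    filter_upwards with τ
    have a1 := hm t ht (x + τ • e) (y + τ • e) (z + τ • e)
    have a2 := hm t ht (x + (-τ) • e) (y + (-τ) • e) (z + (-τ) • e)
    rw [add_sub_add_right_eq_sub] at a1 a2
    rw [← mul_div_assoc, ← add_div, ← sub_div]
    apply div_nonpos_of_nonpos_of_nonneg _ (sq_nonneg _)
    linarith
  have gx : gradv (u t) x = (L / r) • (x - y) := by
    ext i
    have h1 := (ue_line0 (h.diff ht) x (Pi.single i 1)).sub
      ((ueNr_line (x - y) (Pi.single i 1) hr).const_mul L)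
    have := ue_crit h1 (fun τ => by
      have := hm t ht (x + τ • Pi.single i 1) y z
      rw [add_sub_right_comm x _ y] at this
      change u t (x + τ • Pi.single i 1) - L * ueNr (x - y + τ • Pi.single i 1) ≤
        u t (x + (0:ℝ) • Pi.single i 1) - L * ueNr (x - y + (0:ℝ) • Pi.single i 1)
      rw [zero_smul, add_zero, add_zero, ← hrdef]
      linarith)
    rw [ue_dotp_single, ue_dotp_single] at this
    simp only [Pi.smul_apply, smul_eq_mul]
    rw [sub_eq_zero.1 this]; ring
  have gy : gradv (u t) y = (1/2 : ℝ) • gradv (u t) x := by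
    ext i
    have h1 := (ue_line0 (h.diff ht) x (Pi.single i 1)).sub
      ((ue_line0 (h.diff ht) y (Pi.single i 1)).const_mul 2)
    have := ue_crit h1 (fun τ => by
      have := hm t ht (x + τ • Pi.single i 1) (y + τ • Pi.single i 1) z
      rw [add_sub_add_right_eq_sub] at this
      change u t (x + τ • Pi.single i 1) - 2 * u t (y + τ • Pi.single i 1) ≤
        u t (x + (0:ℝ) • Pi.single i 1) - 2 * u t (y + (0:ℝ) • Pi.single i 1)
      rw [zero_smul, add_zero, add_zero]
      linarith)
    rw [ue_dotp_single, ue_dotp_single] at this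
    simp only [Pi.smul_apply, smul_eq_mul]
    linarith
  have gz : gradv (u t) z = 0 := by
    ext i
    have h1 := (ue_line0 (h.diff ht) z (Pi.single i 1))
    have := ue_crit h1 (fun τ => by
      have := hm t ht x y (z + τ • Pi.single i 1)
      simp only [zero_smul, add_zero]
      linarith)
    rwa [ue_dotp_single] at this
  have hsq : sqnorm (gradv (u t) x) = L ^ 2 := by
    rw [gx, ue_sqnorm_smul, ← ueNr_sq, ← hrdef]; field_simp
  have hnp : ‖gradv (u t) x‖ ≤ L := by
    refine (ue_norm_le_nr _).trans ?_
    rw [ueNr, hsq, Real.sqrt_sq (by linarith)]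
  have ex := h.eqn t ht x
  have ey := h.eqn t ht y
  have ez := h.eqn t ht z
  rw [gy] at ey
  rw [gz] at ez
  set p := gradv (u t) x with hp
  have H1 := ue_H_mid S y p
  rw [hsq] at H1
  have H2 := (abs_le.1 (ue_H_lip S p x y)).1
  have H3 := abs_le.1 (hH0 z 0 (by simp))
  have H4 := abs_le.1 (hH0 y 0 (by simp))
  have F1 := abs_le.1 ((hMF (m t) x).trans (le_abs_self _))
  have F2 := abs_le.1 ((hMF (m t) y).trans (le_abs_self _))
  have F3 := abs_le.1 ((hMF (m t) z).trans (le_abs_self _))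
  have hd4 : ‖x - y‖ ≤ 4 := by have := norm_sub_le x y; linarith
  have H5 : d * (S.Cg * (1 + ‖p‖) ^ (1 + S.θ)) * ‖x - y‖ ≤
      d * (S.Cg * (1 + L) ^ (1 + S.θ)) * 4 := by
    have : (1 + ‖p‖) ^ (1 + S.θ) ≤ (1 + L) ^ (1 + S.θ) :=
      Real.rpow_le_rpow (by positivity) (by linarith) (by linarith [S.θ_mem.1])
    gcongr
  have D1 : 0 ≤ δ * (u t x + u t z - 2 * u t y) := by
    apply mul_nonneg h.pos.le
    have := mul_nonneg (by linarith : 0 ≤ L) hr.le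
    linarith
  have fin : S.Cbar⁻¹ * L ^ 2 / 4 ≤ d * (S.Cg * (1 + L) ^ (1 + S.θ)) * 4 + 2 * C0 + 4 * |MF| + 1 := by
    linarith
  set Y := (1 + L) ^ (1 + S.θ) with hY
  have hY1 : 0 ≤ Y := by positivity
  have fin2 : L ^ 2 ≤ 4 * S.Cbar * (d * (S.Cg * Y) * 4 + 2 * C0 + 4 * |MF| + 1) := by
    calc L ^ 2 = 4 * S.Cbar * (S.Cbar⁻¹ * L ^ 2 / 4) := by field_simp
      _ ≤ _ := by gcongr
  have fin3 : 4 * S.Cbar * (d * (S.Cg * Y) * 4 + 2 * C0 + 4 * |MF| + 1) ≤ A * Y + A := by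
    have e1 : A * Y + A - 4 * S.Cbar * (d * (S.Cg * Y) * 4 + 2 * C0 + 4 * |MF| + 1)
       = 4 * S.Cbar * (4 * d * S.Cg + (2 * C0 + 4 * |MF| + 1) * Y) := by rw [hA]; ring
    have : 0 ≤ 4 * S.Cbar * (4 * d * S.Cg + (2 * C0 + 4 * |MF| + 1) * Y) := by positivity
    linarith
  linarith

set_option maxHeartbeats 2000000 in
/-- Step 2: Lipschitz bound. -/
lemma ue_step2 {d : ℕ} (S : MFGSetting d) : ∃ P, 1 ≤ P ∧ ∀ δ u m, UeSol S δ u m →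
    ∀ t, 0 ≤ t → ∀ x y, u t x - u t y ≤ P * ueNr (x - y) := by
  obtain ⟨O, hO1, hO⟩ := ue_step1 S
  obtain ⟨MF, hMF⟩ := S.Fd_bounded
  have hCg := S.Cg_pos
  set A := O * (1 + d * S.Cg + 2 * |MF|) with hA
  have hA0 : 0 ≤ A := by positivity
  obtain ⟨L0, hL1, hL⟩ := ue_growth S.θ_mem A hA0
  set P := max L0 (2 * O) with hP
  have hPL := hL P (le_max_left _ _)
  have hP2 : 2 * O ≤ P := le_max_right _ _
  have hP0 : 0 < P := by linarith
  set k := P / (2 * O) with hk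
  have hk0 : 0 < k := by positivity
  have hk1 : 1 ≤ k := by rw [hk, le_div_iff₀ (by linarith)]; linarith
  have hkP : 2 * O * k = P := by rw [hk]; field_simp
  set φ : ℝ → ℝ := fun r => 2 * O * (1 - Real.exp (-(k * r))) with hφ
  have hφmono : ∀ a b, a ≤ b → φ a ≤ φ b := by
    intro a b hab
    simp only [hφ]
    have : Real.exp (-(k * b)) ≤ Real.exp (-(k * a)) := by
      apply Real.exp_le_exp.2
      have := mul_le_mul_of_nonneg_left hab hk0.le
      linarith
    have hO0 : 0 < O := by linarith
    gcongr
  have hφ0 : φ 0 = 0 := by simp [hφ]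
  have hφnn : ∀ a, 0 ≤ a → 0 ≤ φ a := fun a ha => by rw [← hφ0]; exact hφmono _ _ ha
  have hφle : ∀ a, φ a ≤ P * a := by
    intro a
    have := Real.add_one_le_exp (-(k * a))
    calc φ a ≤ 2 * O * (k * a) := by simp only [hφ]; gcongr; linarith
      _ = P * a := by rw [← hkP]; ring
  have hφd : ∀ a, HasDerivAt φ (P * Real.exp (-(k * a))) a := by
    intro a
    have h1 : HasDerivAt (fun r : ℝ => -(k * r)) (-k) a := by
      exact (((hasDerivAt_id a).const_mul k).neg).congr_deriv (by simp)
    have h2 := ((h1.exp).const_sub 1).const_mul (2 * O)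
    refine h2.congr_deriv ?_
    rw [← hkP]; ring
  have hφc : Continuous φ := continuous_iff_continuousAt.2 fun x => (hφd x).continuousAt
  clear_value φ
  refine ⟨P, by linarith, fun δ u m h t0 ht0 x0 y0 => ?_⟩
  have hO := hO δ u m h
  suffices hs : u t0 x0 - u t0 y0 ≤ φ (ueNr (x0 - y0)) from hs.trans (hφle _)
  by_contra hcon
  push Not at hcon
  set a := u t0 x0 - u t0 y0 - φ (ueNr (x0 - y0)) with ha
  have ha0 : 0 < a := by rw [ha]; linarith
  obtain ⟨M, hM⟩ := h.bdd
  set ε := min 1 (a / (2 * (t0 + 1))) with hε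
  have hεpos : 0 < ε := lt_min one_pos (by positivity)
  have hε1 : ε ≤ 1 := min_le_left _ _
  have hε2 : ε * t0 ≤ a / 2 := by
    have : ε ≤ a / (2 * (t0 + 1)) := min_le_right _ _
    calc ε * t0 ≤ ε * (t0 + 1) := by nlinarith
      _ ≤ a / (2 * (t0 + 1)) * (t0 + 1) := by gcongr
      _ = a / 2 := by field_simp
  obtain ⟨t, ht, ⟨x, y⟩, -, hmax⟩ := ue_max (E := Vd d × Vd d)
    (fun t e => u t e.1 - u t e.2 - φ (ueNr (e.1 - e.2)))
    (by
      refine ContinuousOn.sub (ContinuousOn.sub ?_ ?_) ?_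
      · exact h.contE continuous_fst
      · exact h.contE continuous_snd
      · have := ueNr_continuous (d := d)
        fun_prop) 2 O
    (fun t ht e => by
      obtain ⟨z1, z2, h1, h2, h3⟩ := ue_red_pair e.1 e.2
      refine ⟨(e.1 + intVec z1, e.2 + intVec z2), ?_, ?_⟩
      · simp only [Prod.norm_mk, max_le_iff]
        exact ⟨by linarith, by linarith⟩
      · simp only [h.per t ht]
        have := hφmono _ _ h3
        linarith)
    (fun t ht e => by
      have h1 := hO t ht e.1 e.2
      have h4 := hφnn _ (ueNr_nonneg (e.1 - e.2))
      linarith) ε hεpos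
  have hm : ∀ s, 0 ≤ s → ∀ a b : Vd d, u s a - u s b - φ (ueNr (a - b)) - ε * s ≤
    u t x - u t y - φ (ueNr (x - y)) - ε * t := fun s hs a b => hmax s hs (a, b)
  clear hmax
  have hval : φ (ueNr (x - y)) < u t x - u t y := by
    have h1 := hm t0 ht0 x0 y0
    have h2 : 0 ≤ ε * t := by positivity
    linarith
  have hr : 0 < ueNr (x - y) := by
    apply ueNr_pos
    intro h0
    have : x = y := sub_eq_zero.1 (ueNr_eq_zero h0)
    rw [h0, this, hφ0] at hval
    linarith
  obtain ⟨r, hrdef⟩ : ∃ r, r = ueNr (x - y) := ⟨_, rfl⟩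
  rw [← hrdef] at hm hval hr
  have hexp : 1 / 2 < Real.exp (-(k * r)) := by
    have h1 := hO t ht x y
    have h2 : 2 * O * (1 - Real.exp (-(k * r))) < O := by
      have : φ r < O := by linarith
      simpa [hφ] using this
    nlinarith
  have hkr : k * r < 1 := by
    by_contra hc
    push Not at hc
    have h1 := Real.add_one_le_exp (k * r)
    have h2 : Real.exp (-(k * r)) * Real.exp (k * r) = 1 := by rw [← Real.exp_add]; simp
    nlinarith
  have hr1 : r ≤ 1 := by nlinarith
  have hdist : ‖x - y‖ ≤ 1 := (ue_norm_le_nr _).trans (by rw [← hrdef]; exact hr1)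
  obtain ⟨D, hD⟩ : ∃ D, D = P * Real.exp (-(k * r)) := ⟨_, rfl⟩
  have hDl : P / 2 < D := by
    have := mul_lt_mul_of_pos_left hexp hP0
    rw [hD]; linarith
  have hDu : D ≤ P := by
    have : Real.exp (-(k * r)) ≤ 1 := Real.exp_le_one_iff.2 (by
      have := mul_pos hk0 hr
      linarith)
    have := mul_le_mul_of_nonneg_left this hP0.le
    rw [hD]; linarith
  have htime : tderiv u t x - tderiv u t y ≤ ε := by
    refine ue_time (g := fun s => u s x - u s y)
      ((h.dt t ht x).sub (h.dt t ht y)) (fun s hs => ?_)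
    have := hm s (ht.trans hs) x y
    rw [← hrdef] at this
    linarith
  have gx : gradv (u t) x = (D / r) • (x - y) := by
    ext i
    have h2 : HasDerivAt (fun τ : ℝ => φ (ueNr (x - y + τ • Pi.single i 1)))
        (D * (dotp (x - y) (Pi.single i 1) / ueNr (x - y))) 0 := by
      have h3 : HasDerivAt φ D (ueNr (x - y + (0:ℝ) • Pi.single i 1)) := by
        rw [zero_smul, add_zero, ← hrdef, hD]; exact hφd r
      exact h3.comp (0:ℝ) (ueNr_line (x - y) (Pi.single i 1) (by rw [← hrdef]; exact hr))
    have h1 := (ue_line0 (h.diff ht) x (Pi.single i 1)).sub h2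
    have := ue_crit h1 (fun τ => by
      have := hm t ht (x + τ • Pi.single i 1) y
      rw [add_sub_right_comm x _ y] at this
      change u t (x + τ • Pi.single i 1) - φ (ueNr (x - y + τ • Pi.single i 1)) ≤
        u t (x + (0:ℝ) • Pi.single i 1) - φ (ueNr (x - y + (0:ℝ) • Pi.single i 1))
      rw [zero_smul, add_zero, add_zero, ← hrdef]
      linarith)
    rw [ue_dotp_single, ue_dotp_single, ← hrdef] at this
    simp only [Pi.smul_apply, smul_eq_mul]
    rw [sub_eq_zero.1 this]; ring
  have gy : gradv (u t) y = gradv (u t) x := by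
    ext i
    have h1 := (ue_line0 (h.diff ht) x (Pi.single i 1)).sub
      (ue_line0 (h.diff ht) y (Pi.single i 1))
    have := ue_crit h1 (fun τ => by
      have := hm t ht (x + τ • Pi.single i 1) (y + τ • Pi.single i 1)
      rw [add_sub_add_right_eq_sub, ← hrdef] at this
      change u t (x + τ • Pi.single i 1) - u t (y + τ • Pi.single i 1) ≤
        u t (x + (0:ℝ) • Pi.single i 1) - u t (y + (0:ℝ) • Pi.single i 1)
      rw [zero_smul, add_zero, add_zero]
      linarith)
    rw [ue_dotp_single, ue_dotp_single] at this
    linarith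
  set n : Vd d := r⁻¹ • (x - y) with hn
  have hn1 : sqnorm n = 1 := by
    rw [hn, ue_sqnorm_smul, ← ueNr_sq, ← hrdef]; field_simp
  have hxyn : x - y = r • n := by rw [hn, smul_smul, mul_inv_cancel₀ hr.ne', one_smul]
  have hnr : ueNr n = 1 := by rw [ueNr, hn1, Real.sqrt_one]
  clear_value n
  have hlap : lapl (u t) x - lapl (u t) y + 4 * k * D ≤ 0 := by
    have e4 : 4 * k * D = ∑ i, 4 * k * D * (n i) ^ 2 := by
      rw [← Finset.mul_sum]; change 4 * k * D = 4 * k * D * sqnorm n; rw [hn1, mul_one]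
    rw [← ue_lapl_add (h.sm t ht) y n hn1, lapl, e4, ← Finset.sum_sub_distrib, ← Finset.sum_add_distrib]
    apply Finset.sum_nonpos
    intro i _
    set e : Vd d := Pi.single i 1
    set b : Vd d := e - (2 * n i) • n with hb
    have hf1 : ∀ τ : ℝ, HasDerivAt (fun τ : ℝ => φ (r + 2 * n i * τ))
        (P * Real.exp (-(k * (r + 2 * n i * τ))) * (2 * n i)) τ := by
      intro τ
      have h1 : HasDerivAt (fun τ : ℝ => r + 2 * n i * τ) (2 * n i) τ := by
        simpa using ((hasDerivAt_id τ).const_mul (2 * n i)).const_add r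
      exact (hφd _).comp τ h1
    have hf2 : HasDerivAt (fun τ : ℝ => P * Real.exp (-(k * (r + 2 * n i * τ))) * (2 * n i))
        (-(4 * k * D * (n i) ^ 2)) 0 := by
      have h1 : HasDerivAt (fun τ : ℝ => r + 2 * n i * τ) (2 * n i) 0 := by
        simpa using ((hasDerivAt_id (0:ℝ)).const_mul (2 * n i)).const_add r
      have h2 := ((((h1.const_mul k).neg).exp).const_mul P).mul_const (2 * n i)
      refine h2.congr_deriv ?_
      simp only [Pi.neg_apply, mul_zero, add_zero]
      rw [hD]; ring
    have T := ((ue_sd (h.sm t ht) x e).sub (ue_sd (h.sm t ht) y b)).sub (ue_sd1 hf1 hf2)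
    rw [sub_neg_eq_add] at T
    refine ue_lim_le T ?_
    have ev : ∀ᶠ τ : ℝ in 𝓝 0, 0 < r + 2 * n i * τ ∧ 0 < r + 2 * n i * (-τ) := by
      refine Filter.Eventually.and ?_ ?_
      · have : Continuous fun τ : ℝ => r + 2 * n i * τ := by fun_prop
        exact this.continuousAt.eventually (lt_mem_nhds (by simpa using hr))
      · have : Continuous fun τ : ℝ => r + 2 * n i * (-τ) := by fun_prop
        exact this.continuousAt.eventually (lt_mem_nhds (by simpa using hr))
    filter_upwards [mem_nhdsWithin_of_mem_nhds ev] with τ hτ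
    have key : ∀ σ : ℝ, 0 < r + 2 * n i * σ →
        ueNr (x + σ • e - (y + σ • b)) = r + 2 * n i * σ := by
      intro σ hσ
      have : x + σ • e - (y + σ • b) = (r + 2 * n i * σ) • n := by
        ext j
        have hj := congrFun hxyn j
        simp only [Pi.sub_apply, Pi.smul_apply, smul_eq_mul] at hj
        simp only [hb, Pi.sub_apply, Pi.add_apply, Pi.smul_apply, smul_eq_mul]
        linear_combination hj
      rw [this, ueNr_smul, hnr, mul_one, abs_of_pos hσ]
    have a1 := hm t ht (x + τ • e) (y + τ • b)
    have a2 := hm t ht (x + (-τ) • e) (y + (-τ) • b)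
    rw [key _ hτ.1] at a1
    rw [key _ hτ.2] at a2
    rw [← sub_div, ← sub_div]
    apply div_nonpos_of_nonpos_of_nonneg _ (sq_nonneg _)
    simp only [mul_zero, add_zero]
    linarith
  have hsq : sqnorm (gradv (u t) x) = D ^ 2 := by
    rw [gx, ue_sqnorm_smul, ← ueNr_sq, ← hrdef]; field_simp
  have hnp : ‖gradv (u t) x‖ ≤ P := by
    refine (ue_norm_le_nr _).trans ?_
    rw [ueNr, hsq, Real.sqrt_sq (by linarith)]
    exact hDu
  have ex := h.eqn t ht x
  have ey := h.eqn t ht y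
  rw [gy] at ey
  set p := gradv (u t) x with hp
  have H2 := (abs_le.1 (ue_H_lip S p x y)).1
  have F1 := abs_le.1 ((hMF (m t) x).trans (le_abs_self _))
  have F2 := abs_le.1 ((hMF (m t) y).trans (le_abs_self _))
  have H5 : d * (S.Cg * (1 + ‖p‖) ^ (1 + S.θ)) * ‖x - y‖ ≤
      d * (S.Cg * (1 + P) ^ (1 + S.θ)) * 1 := by
    have : (1 + ‖p‖) ^ (1 + S.θ) ≤ (1 + P) ^ (1 + S.θ) :=
      Real.rpow_le_rpow (by positivity) (by linarith) (by linarith [S.θ_mem.1])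
    gcongr
  have D1 : 0 ≤ δ * (u t x - u t y) := by
    apply mul_nonneg h.pos.le
    have := hφnn r hr.le
    linarith
  have fin : 4 * k * D ≤ 1 + d * (S.Cg * (1 + P) ^ (1 + S.θ)) + 2 * |MF| := by
    linarith
  set Y := (1 + P) ^ (1 + S.θ) with hY
  have hY1 : 0 ≤ Y := by positivity
  have fin2 : P ^ 2 ≤ O * (4 * k * D) := by
    have : O * (4 * k * D) = 2 * P * D := by rw [← hkP]; ring
    rw [this]; nlinarith
  have fin4 : O * (4 * k * D) ≤ O * (1 + d * (S.Cg * Y) + 2 * |MF|) := by gcongr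
  have fin3 : O * (1 + d * (S.Cg * Y) + 2 * |MF|) ≤ A * Y + A := by
    have e1 : A * Y + A - O * (1 + d * (S.Cg * Y) + 2 * |MF|)
       = O * ((1 + 2 * |MF|) * Y + d * S.Cg) := by rw [hA]; ring
    have : 0 ≤ O * ((1 + 2 * |MF|) * Y + d * S.Cg) := by positivity
    linarith
  linarith

lemma ue_grad_le {d : ℕ} {g : Vd d → ℝ} (hg : Differentiable ℝ g) {P : ℝ} (hP : 0 ≤ P)
    (h : ∀ x y, g x - g y ≤ P * ueNr (x - y)) (x : Vd d) : ueNr (gradv g x) ≤ P := by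
  have h1 := (ue_line0 hg x (gradv g x)).tendsto_slope_zero_right
  have h2 : dotp (gradv g x) (gradv g x) ≤ P * ueNr (gradv g x) := by
    refine le_of_tendsto h1 ?_
    filter_upwards [self_mem_nhdsWithin] with τ hτ
    have hτ' : (0:ℝ) < τ := hτ
    rw [smul_eq_mul, inv_mul_le_iff₀ hτ']
    have := h (x + τ • gradv g x) x
    rw [add_sub_cancel_left, ueNr_smul, abs_of_pos hτ'] at this
    simp only [zero_add, zero_smul, add_zero]
    linarith
  rw [ue_dotp_self, ← ueNr_sq] at h2
  by_contra hc
  push Not at hc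
  nlinarith

lemma ue_abs_mul {a b A B : ℝ} (ha : |a| ≤ A) (hb : |b| ≤ B) : |a * b| ≤ A * B := by
  rw [abs_mul]
  exact mul_le_mul ha hb (abs_nonneg _) ((abs_nonneg _).trans ha)

lemma ue_alg {s lam vp vm L η ap am Hp Hm kp km lh CH r1 r2 Qp Qm Fp Fm f s1 s2 dF F Dl ε : ℝ}
    (hlam : 0 ≤ lam) (hap : ap = s + 2 * lam * vp) (ham : am = s + 2 * lam * vm)
    (hap2 : |ap| ≤ 2) (ham2 : |am| ≤ 2)
    (hvp : |vp| ≤ L * η) (hvm : |vm| ≤ L * η) (hHp : Hp = kp + lh + r1) (hHm : Hm = km - lh + r2)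
    (hk : ap * kp + am * km = 0) (hlh : |lh| ≤ CH * η) (hr1 : |r1| ≤ CH * (η ^ 2 + Qp))
    (hr2 : |r2| ≤ CH * (η ^ 2 + Qm)) (hFp : Fp = f + s1) (hFm : Fm = - f + s2)
    (hf : |f| ≤ dF * η) (hs1 : |s1| ≤ F * η ^ 2) (hs2 : |s2| ≤ F * η ^ 2) (hD : 0 ≤ Dl)
    (hin : Dl + ap * Hp + am * Hm - ap * Fp - am * Fm + 2 * lam * (Qp + Qm) ≤ ε) :
    (2 * lam - 2 * CH) * (Qp + Qm) ≤
      ε + (4 * lam * L * CH + 4 * CH + 4 * lam * L * dF + 4 * F) * η ^ 2 := by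
  have hd : |ap - am| ≤ 4 * lam * (L * η) := by
    have : ap - am = 2 * lam * (vp - vm) := by rw [hap, ham]; ring
    rw [this, abs_mul, abs_of_nonneg (by linarith : 0 ≤ 2 * lam)]
    have : |vp - vm| ≤ 2 * (L * η) := (abs_sub _ _).trans (by linarith)
    calc 2 * lam * |vp - vm| ≤ 2 * lam * (2 * (L * η)) := by gcongr
      _ = _ := by ring
  have e1 := (abs_le.1 (ue_abs_mul hd hlh)).1
  have e2 := (abs_le.1 (ue_abs_mul hd hf)).2
  have e3 := (abs_le.1 (ue_abs_mul hap2 hr1)).1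
  have e4 := (abs_le.1 (ue_abs_mul ham2 hr2)).1
  have e5 := (abs_le.1 (ue_abs_mul hap2 hs1)).2
  have e6 := (abs_le.1 (ue_abs_mul ham2 hs2)).2
  have e7 : Dl + ap * Hp + am * Hm - ap * Fp - am * Fm = Dl + (ap * kp + am * km) +
    (ap - am) * lh + ap * r1 + am * r2 - ((ap - am) * f + ap * s1 + am * s2) := by
    rw [hHp, hHm, hFp, hFm]; ring
  rw [e7, hk] at hin
  nlinarith

def ueV {d : ℕ} (g : Vd d → ℝ) (s lam : ℝ) (x h : Vd d) : ℝ :=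
  s * (g (x + h) - g x) + lam * (g (x + h) - g x) ^ 2

lemma ueV_line {d : ℕ} {g : Vd d → ℝ} (hg : ContDiff ℝ 2 g) (s lam : ℝ) (x h e : Vd d) :
    ∃ f' : ℝ → ℝ, (∀ τ, HasDerivAt (fun τ : ℝ => ueV g s lam (x + τ • e) h) (f' τ) τ) ∧
      f' 0 = (s + 2 * lam * (g (x + h) - g x)) * dotp (gradv g (x + h) - gradv g x) e ∧
      HasDerivAt f' ((s + 2 * lam * (g (x + h) - g x)) * (D2 g (x + h) e e - D2 g x e e) +
        2 * lam * (dotp (gradv g (x + h) - gradv g x) e) ^ 2) 0 := by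
  have hd := hg.differentiable (by norm_num)
  have hds : dotp (gradv g (x + h) - gradv g x) e = fderiv ℝ g (x + h) e - fderiv ℝ g x e := by
    rw [ue_fderiv_dotp, ue_fderiv_dotp]
    simp only [dotp, ← Finset.sum_sub_distrib, Pi.sub_apply, sub_mul]
  have hv : ∀ τ : ℝ, HasDerivAt (fun τ : ℝ => g (x + τ • e + h) - g (x + τ • e))
      (fderiv ℝ g (x + h + τ • e) e - fderiv ℝ g (x + τ • e) e) τ := by
    intro τ
    have h1 := (ue_line hd (x + h) e τ).sub (ue_line hd x e τ)
    refine h1.congr_of_eventuallyEq (Eventually.of_forall fun σ => ?_)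
    change g (x + σ • e + h) - g (x + σ • e) = g (x + h + σ • e) - g (x + σ • e)
    rw [add_right_comm]
  have hv1 : HasDerivAt (fun τ : ℝ => fderiv ℝ g (x + h + τ • e) e - fderiv ℝ g (x + τ • e) e)
      (D2 g (x + h) e e - D2 g x e e) 0 := by
    have h1 := (ue_line (ue_diff2' hg e) (x + h) e 0).sub (ue_line (ue_diff2' hg e) x e 0)
    rw [zero_smul, add_zero, add_zero] at h1
    exact h1
  refine ⟨fun τ => (s + 2 * lam * (g (x + τ • e + h) - g (x + τ • e))) *
    (fderiv ℝ g (x + h + τ • e) e - fderiv ℝ g (x + τ • e) e), fun τ => ?_, ?_, ?_⟩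
  · have h1 := ((hv τ).const_mul s).add (((hv τ).pow 2).const_mul lam)
    refine h1.congr_deriv ?_
    simp only [Nat.cast_ofNat, Nat.add_one_sub_one, pow_one]
    ring
  · simp only [zero_smul, add_zero]
    rw [hds]
  · have h1 := (((hv 0).const_mul (2 * lam)).const_add s).mul hv1
    refine h1.congr_deriv ?_
    simp only [zero_smul, add_zero]
    rw [hds]; ring

lemma ueV_hline {d : ℕ} {g : Vd d → ℝ} (hg : ContDiff ℝ 2 g) (s lam : ℝ) (x h e : Vd d) :
    HasDerivAt (fun τ : ℝ => ueV g s lam x (h + τ • e))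
      ((s + 2 * lam * (g (x + h) - g x)) * dotp (gradv g (x + h)) e) 0 := by
  have hd := hg.differentiable (by norm_num)
  have hv : HasDerivAt (fun τ : ℝ => g (x + (h + τ • e)) - g x) (dotp (gradv g (x + h)) e) 0 := by
    have h1 := (ue_line0 hd (x + h) e).sub_const (g x)
    refine h1.congr_of_eventuallyEq (Eventually.of_forall fun σ => ?_)
    change g (x + (h + σ • e)) - g x = g (x + h + σ • e) - g x
    rw [add_assoc]
  have h1 := ((hv).const_mul s).add (((hv).pow 2).const_mul lam)
  refine h1.congr_deriv ?_
  simp only [zero_smul, add_zero, Nat.cast_ofNat, Nat.add_one_sub_one, pow_one]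
  ring

lemma ue_sqnorm_line {d : ℕ} (h e : Vd d) :
    HasDerivAt (fun τ : ℝ => sqnorm (h + τ • e)) (2 * dotp h e) 0 := by
  have h1 : (fun τ : ℝ => sqnorm (h + τ • e)) =
      fun τ : ℝ => sqnorm h + 2 * dotp h e * τ + sqnorm e * τ ^ 2 := by
    ext τ
    simp only [sqnorm, dotp, Finset.mul_sum, Finset.sum_mul, ← Finset.sum_add_distrib]
    exact Finset.sum_congr rfl fun i _ => by simp only [Pi.add_apply, Pi.smul_apply, smul_eq_mul]; ring
  rw [h1]
  have := (((hasDerivAt_id (0:ℝ)).const_mul (2 * dotp h e)).const_add (sqnorm h)).add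
    ((hasDerivAt_pow 2 (0:ℝ)).const_mul (sqnorm e))
  refine this.congr_deriv ?_
  simp

lemma ue_dotp_neg {d : ℕ} (a b : Vd d) : dotp a (-b) = - dotp a b := by
  simp [dotp]

lemma ue_dt_V {d : ℕ} {u : ℝ → Vd d → ℝ} {t : ℝ} (s lam : ℝ) (x h : Vd d)
    (hd : ∀ x, HasDerivAt (fun s => u s x) (tderiv u t x) t) :
    HasDerivAt (fun σ => ueV (u σ) s lam x h)
     ((s + 2 * lam * (u t (x + h) - u t x)) * (tderiv u t (x + h) - tderiv u t x)) t := by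
  have hv := (hd (x + h)).sub (hd x)
  have h1 := ((hv).const_mul s).add (((hv).pow 2).const_mul lam)
  refine h1.congr_deriv ?_
  simp only [Pi.sub_apply, Nat.cast_ofNat, Nat.add_one_sub_one, pow_one]
  ring

/-- Second-order information at a space maximum. -/
lemma ueV_second {d : ℕ} {g : Vd d → ℝ} (hg : ContDiff ℝ 2 g) (s lam : ℝ) (x h : Vd d)
    (hm : ∀ y, ueV g s lam y h + ueV g s lam y (-h) ≤ ueV g s lam x h + ueV g s lam x (-h)) :
    (s + 2 * lam * (g (x + h) - g x)) • (gradv g (x + h) - gradv g x) +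
      (s + 2 * lam * (g (x + -h) - g x)) • (gradv g (x + -h) - gradv g x) = 0 ∧
    (s + 2 * lam * (g (x + h) - g x)) * (lapl g (x + h) - lapl g x) +
      (s + 2 * lam * (g (x + -h) - g x)) * (lapl g (x + -h) - lapl g x) +
      2 * lam * (sqnorm (gradv g (x + h) - gradv g x) + sqnorm (gradv g (x + -h) - gradv g x)) ≤ 0 := by
  constructor
  · ext i
    obtain ⟨f1, h1, h2, -⟩ := ueV_line hg s lam x h (Pi.single i 1)
    obtain ⟨f2, h3, h4, -⟩ := ueV_line hg s lam x (-h) (Pi.single i 1)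
    have := ue_crit ((h1 0).add (h3 0)) (fun τ => by
      have := hm (x + τ • Pi.single i 1)
      change ueV g s lam (x + τ • Pi.single i 1) h + ueV g s lam (x + τ • Pi.single i 1) (-h) ≤
        ueV g s lam (x + (0:ℝ) • Pi.single i 1) h + ueV g s lam (x + (0:ℝ) • Pi.single i 1) (-h)
      rw [zero_smul, add_zero]
      exact this)
    rw [h2, h4, ue_dotp_single, ue_dotp_single] at this
    simpa using this
  · have key : ∀ i : Fin d, (s + 2 * lam * (g (x + h) - g x)) *
        (D2 g (x + h) (Pi.single i 1) (Pi.single i 1) - D2 g x (Pi.single i 1) (Pi.single i 1)) +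
        2 * lam * ((gradv g (x + h) - gradv g x) i) ^ 2 +
        ((s + 2 * lam * (g (x + -h) - g x)) *
        (D2 g (x + -h) (Pi.single i 1) (Pi.single i 1) - D2 g x (Pi.single i 1) (Pi.single i 1)) +
        2 * lam * ((gradv g (x + -h) - gradv g x) i) ^ 2) ≤ 0 := by
      intro i
      obtain ⟨f1, h1, -, h2⟩ := ueV_line hg s lam x h (Pi.single i 1)
      obtain ⟨f2, h3, -, h4⟩ := ueV_line hg s lam x (-h) (Pi.single i 1)
      rw [ue_dotp_single] at h2 h4
      refine ue_lim_le ((ue_sd1 h1 h2).add (ue_sd1 h3 h4)) ?_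
      filter_upwards with τ
      have a1 := hm (x + τ • Pi.single i 1)
      have a2 := hm (x + (-τ) • Pi.single i 1)
      rw [← add_div]
      apply div_nonpos_of_nonpos_of_nonneg _ (sq_nonneg _)
      rw [zero_smul, add_zero]
      linarith
    have := Finset.sum_nonpos (s := Finset.univ) (fun i _ => key i)
    simp only [Finset.sum_add_distrib, ← Finset.mul_sum, Finset.sum_sub_distrib] at this
    simp only [lapl, sqnorm]
    linarith

/-- First-order information in `h`. -/
lemma ueV_first {d : ℕ} {g : Vd d → ℝ} (hg : ContDiff ℝ 2 g) (s lam K : ℝ) (x h : Vd d)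
    (hm : ∀ k, ueV g s lam x k + ueV g s lam x (-k) - K * sqnorm k ≤
      ueV g s lam x h + ueV g s lam x (-h) - K * sqnorm h) :
    (s + 2 * lam * (g (x + h) - g x)) • gradv g (x + h) -
      (s + 2 * lam * (g (x + -h) - g x)) • gradv g (x + -h) = (2 * K) • h := by
  ext i
  have h1 := ueV_hline hg s lam x h (Pi.single i 1)
  have h2 := ueV_hline hg s lam x (-h) (-Pi.single i 1)
  have := ue_crit ((h1.add h2).sub ((ue_sqnorm_line h (Pi.single i 1)).const_mul K)) (fun τ => by
    have := hm (h + τ • Pi.single i 1)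
    change ueV g s lam x (h + τ • Pi.single i 1) + ueV g s lam x (-h + τ • -Pi.single i 1) -
      K * sqnorm (h + τ • Pi.single i 1) ≤ ueV g s lam x (h + (0:ℝ) • Pi.single i 1) +
      ueV g s lam x (-h + (0:ℝ) • -Pi.single i 1) - K * sqnorm (h + (0:ℝ) • Pi.single i 1)
    rw [zero_smul, zero_smul, add_zero, add_zero, smul_neg, ← neg_add]
    exact this)
  rw [ue_dotp_neg, ue_dotp_single, ue_dotp_single, ue_dotp_single] at this
  simp only [Pi.sub_apply, Pi.smul_apply, smul_eq_mul]
  linarith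

lemma ueV_abs {d : ℕ} {g : Vd d → ℝ} {L : ℝ} (hg : ∀ x y, g x - g y ≤ L * ueNr (x - y))
    (x h : Vd d) : |g (x + h) - g x| ≤ L * ueNr h := by
  have h1 := hg (x + h) x
  have h2 := hg x (x + h)
  rw [add_sub_cancel_left] at h1
  rw [sub_add_cancel_left, ueNr_neg] at h2
  rw [abs_le]; constructor <;> linarith

lemma ueV_le {d : ℕ} {g : Vd d → ℝ} {L : ℝ} (hg : ∀ x y, g x - g y ≤ L * ueNr (x - y))
    {s lam : ℝ} (hs : |s| = 1) (hlam : 0 ≤ lam) (x h : Vd d) :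
    ueV g s lam x h ≤ L * ueNr h + lam * L ^ 2 * ueNr h ^ 2 := by
  have h1 := ueV_abs hg x h
  have h2 : s * (g (x + h) - g x) ≤ L * ueNr h := by
    refine (le_abs_self _).trans ?_
    rw [abs_mul, hs, one_mul]; exact h1
  have h3 : (g (x + h) - g x) ^ 2 ≤ (L * ueNr h) ^ 2 := by
    rw [← sq_abs]
    gcongr
  have h4 := mul_le_mul_of_nonneg_left h3 hlam
  rw [ueV]
  linarith

set_option maxHeartbeats 2000000 in
/-- The contradiction argument for the second derivatives, at the maximum point. -/
lemma ue_step3_pt {d : ℕ} (S : MFGSetting d) {L CH : ℝ} (hL : 1 ≤ L) (hCH : 0 ≤ CH)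
    (hT : ∀ x p, ‖p‖ ≤ L → ∃ l k : Vd d →L[ℝ] ℝ, (∀ h, |l h| ≤ CH * ‖h‖) ∧
      ∀ h q, ‖h‖ ≤ 1 → ‖p + q‖ ≤ L →
        |S.H (x + h) (p + q) - S.H x p - k q - l h| ≤ CH * (‖h‖ ^ 2 + ‖q‖ ^ 2))
    {δ : ℝ} {u : ℝ → Vd d → ℝ} {m : ℝ → PTd d} (h : UeSol S δ u m)
    (hLip : ∀ t, 0 ≤ t → ∀ x y, u t x - u t y ≤ L * ueNr (x - y))
    {s lam C2 K' : ℝ} (hs : |s| = 1) (hlam : lam = CH + 1)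
    (hC2 : C2 = 4 * lam * L * CH + 4 * CH + 4 * lam * L * (d * |S.CF|) + 4 * |S.CF|)
    (hK' : K' = 2 * L + 8 * lam * L ^ 2 + 2 * C2 + 2)
    {t ε : ℝ} (ht : 0 ≤ t) (x η : Vd d)
    (hpos : 0 < ueV (u t) s lam x η + ueV (u t) s lam x (-η) - (K' + 2 * lam * L ^ 2) * sqnorm η)
    (hm : ∀ r, 0 ≤ r → ∀ y k, 
      ueV (u r) s lam y k + ueV (u r) s lam y (-k) - (K' + 2 * lam * L ^ 2) * sqnorm k - ε * r ≤
      ueV (u t) s lam x η + ueV (u t) s lam x (-η) - (K' + 2 * lam * L ^ 2) * sqnorm η - ε * t) :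
    ueNr η ^ 2 ≤ ε := by
  have hlam0 : 1 ≤ lam := by linarith
  have hC20 : 0 ≤ C2 := by rw [hC2]; positivity
  set K := K' + 2 * lam * L ^ 2 with hK
  have hgL : ∀ y, ueNr (gradv (u t) y) ≤ L := ue_grad_le (h.diff ht) (by linarith) (hLip t ht)
  have hgL' : ∀ y, ‖gradv (u t) y‖ ≤ L := fun y => (ue_norm_le_nr _).trans (hgL y)
  obtain ⟨N, hN⟩ : ∃ N, N = ueNr η := ⟨_, rfl⟩
  have hN0 : 0 ≤ N := by rw [hN]; exact ueNr_nonneg _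
  rw [← hN]
  -- smallness of `η`
  have hvp : |u t (x + η) - u t x| ≤ L * N := by rw [hN]; exact ueV_abs (hLip t ht) x η
  have hvm : |u t (x + -η) - u t x| ≤ L * N := by
    have := ueV_abs (hLip t ht) x (-η)
    rwa [ueNr_neg, ← hN] at this
  have hVp := ueV_le (hLip t ht) hs (by linarith : 0 ≤ lam) x η
  have hVm := ueV_le (hLip t ht) hs (by linarith : 0 ≤ lam) x (-η)
  rw [ueNr_neg] at hVm
  rw [← hN] at hVp hVm
  have hK'0 : 0 < K' := by rw [hK']; positivity
  have hsmall : K' * N ≤ 2 * L := by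
    have h1 : 0 < 2 * L * N - K' * N ^ 2 := by
      rw [← ueNr_sq, ← hN, hK] at hpos
      linarith
    by_contra hc
    push Not at hc
    nlinarith
  have hN1 : N ≤ 1 := by
    by_contra hc
    push Not at hc
    have : K' < K' * N := by nlinarith
    have : 0 ≤ lam * L ^ 2 := by positivity
    linarith
  have hlN : lam * (L * N) ≤ 1 / 4 := by
    have h1 : 8 * lam * L ^ 2 * N ≤ K' * N := by
      apply mul_le_mul_of_nonneg_right _ hN0
      linarith
    have h2 : L * (8 * (lam * (L * N))) ≤ L * 2 := by linarith
    have := le_of_mul_le_mul_left h2 (by linarith)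
    linarith
  have habs : ∀ v, |v| ≤ L * N → |s + 2 * lam * v| ≤ 2 := by
    intro v hv
    have h1 : |2 * lam * v| ≤ 1 := by
      rw [abs_mul, abs_of_nonneg (by linarith : 0 ≤ 2 * lam)]
      have := mul_le_mul_of_nonneg_left hv (by linarith : 0 ≤ 2 * lam)
      linarith
    have := abs_add_le s (2 * lam * v)
    linarith
  obtain ⟨ap, hap⟩ : ∃ ap, ap = s + 2 * lam * (u t (x + η) - u t x) := ⟨_, rfl⟩
  obtain ⟨am, ham⟩ : ∃ am, am = s + 2 * lam * (u t (x + -η) - u t x) := ⟨_, rfl⟩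
  have hap2 : |ap| ≤ 2 := by rw [hap]; exact habs _ hvp
  have ham2 : |am| ≤ 2 := by rw [ham]; exact habs _ hvm
  obtain ⟨p, hp⟩ : ∃ p, p = gradv (u t) x := ⟨_, rfl⟩
  obtain ⟨qp, hqp⟩ : ∃ q, q = gradv (u t) (x + η) - gradv (u t) x := ⟨_, rfl⟩
  obtain ⟨qm, hqm⟩ : ∃ q, q = gradv (u t) (x + -η) - gradv (u t) x := ⟨_, rfl⟩
  have hpp : gradv (u t) (x + η) = p + qp := by rw [hp, hqp]; abel
  have hpm : gradv (u t) (x + -η) = p + qm := by rw [hp, hqm]; abel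
  obtain ⟨c1, c2⟩ := ueV_second (h.sm t ht) s lam x η (fun y => by have := hm t ht y η; linarith)
  have c3 := ueV_first (h.sm t ht) s lam K x η (fun k => by have := hm t ht x k; linarith)
  rw [← hap, ← ham, ← hqp, ← hqm] at c1 c2
  rw [← hap, ← ham, hpp, hpm] at c3
  have htime : ap * (tderiv u t (x + η) - tderiv u t x) +
      am * (tderiv u t (x + -η) - tderiv u t x) ≤ ε := by
    rw [hap, ham]
    refine ue_time ((ue_dt_V s lam x η (h.dt t ht)).add (ue_dt_V s lam x (-η) (h.dt t ht)))
      (fun r hr => ?_)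
    have := hm r (ht.trans hr) x η
    simp only [Pi.add_apply]
    linarith
  have e0 := h.eqn t ht x
  have e1 := h.eqn t ht (x + η)
  have e2 := h.eqn t ht (x + -η)
  rw [← hp] at e0
  rw [hpp] at e1
  rw [hpm] at e2
  obtain ⟨l, k, hl, hlk⟩ := hT x p (by rw [hp]; exact hgL' x)
  obtain ⟨lF, hlF, hlF2⟩ := ue_F_taylor S (m t) x
  have hηn : ‖η‖ ≤ N := by rw [hN]; exact ue_norm_le_nr _
  have hη1 : ‖η‖ ≤ 1 := hηn.trans hN1
  have hηsq : ‖η‖ ^ 2 ≤ N ^ 2 := by gcongr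
  have T1 := hlk η qp hη1 (by rw [← hpp]; exact hgL' _)
  have T2 := hlk (-η) qm (by rwa [norm_neg]) (by rw [← hpm]; exact hgL' _)
  have G1 := hlF2 η
  have G2 := hlF2 (-η)
  rw [norm_neg] at T2 G2
  rw [map_neg] at T2 G2
  have hQp : ‖qp‖ ^ 2 ≤ sqnorm qp := by
    rw [← ueNr_sq]; have := ue_norm_le_nr qp; gcongr
  have hQm : ‖qm‖ ^ 2 ≤ sqnorm qm := by
    rw [← ueNr_sq]; have := ue_norm_le_nr qm; gcongr
  have hk0 : ap * k qp + am * k qm = 0 := by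
    have := congrArg k c1
    simpa using this
  have hDl : 0 ≤ δ * (ap * (u t (x + η) - u t x) + am * (u t (x + -η) - u t x)) := by
    apply mul_nonneg h.pos.le
    have h1 : 0 ≤ K * sqnorm η := mul_nonneg (by positivity) (ue_sqnorm_nonneg _)
    have h2 : 0 ≤ lam * (u t (x + η) - u t x) ^ 2 := by positivity
    have h3 : 0 ≤ lam * (u t (x + -η) - u t x) ^ 2 := by positivity
    simp only [ueV] at hpos
    rw [hap, ham]
    linarith
  have fin := ue_alg (L := L) (η := N) (CH := CH) (ε := ε) (dF := d * |S.CF|) (F := |S.CF|)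
    (by linarith : 0 ≤ lam) hap ham hap2 ham2 hvp hvm
    (Hp := S.H (x + η) (p + qp) - S.H x p) (Hm := S.H (x + -η) (p + qm) - S.H x p)
    (kp := k qp) (km := k qm) (lh := l η)
    (r1 := S.H (x + η) (p + qp) - S.H x p - k qp - l η)
    (r2 := S.H (x + -η) (p + qm) - S.H x p - k qm - -l η)
    (Fp := S.Fd (m t : Measure (Td d)) (x + η) - S.Fd (m t : Measure (Td d)) x)
    (Fm := S.Fd (m t : Measure (Td d)) (x + -η) - S.Fd (m t : Measure (Td d)) x)
    (f := lF η) (s1 := S.Fd (m t : Measure (Td d)) (x + η) - S.Fd (m t : Measure (Td d)) x - lF η)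
    (s2 := S.Fd (m t : Measure (Td d)) (x + -η) - S.Fd (m t : Measure (Td d)) x - -lF η)
    (Qp := sqnorm qp) (Qm := sqnorm qm)
    (by ring) (by ring) hk0 ((hl η).trans (by gcongr)) (T1.trans (by gcongr)) (T2.trans (by gcongr))
    (by ring) (by ring) ((hlF η).trans (by gcongr)) (G1.trans (by gcongr)) (G2.trans (by gcongr))
    hDl (by
      have E1 : tderiv u t (x + η) - tderiv u t x + (lapl (u t) (x + η) - lapl (u t) x) =
        δ * (u t (x + η) - u t x) + (S.H (x + η) (p + qp) - S.H x p)
        - (S.Fd (m t : Measure (Td d)) (x + η) - S.Fd (m t : Measure (Td d)) x) := by linarith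
      have E2 : tderiv u t (x + -η) - tderiv u t x + (lapl (u t) (x + -η) - lapl (u t) x) =
        δ * (u t (x + -η) - u t x) + (S.H (x + -η) (p + qm) - S.H x p)
        - (S.Fd (m t : Measure (Td d)) (x + -η) - S.Fd (m t : Measure (Td d)) x) := by linarith
      have E3 : ap * _ = ap * _ := congrArg (fun z => ap * z) E1
      have E4 : am * _ = am * _ := congrArg (fun z => am * z) E2
      linarith)
  rw [← hC2] at fin
  -- lower bound for `qp`
  have low : 2 * K' * N ≤ 4 * ueNr qp := by
    have e : (2 * K) • η = (2 * ap) • qp + (ap - am) • p := by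
      rw [← c3]
      have : am • qm = - (ap • qp) := by rw [eq_neg_iff_add_eq_zero, add_comm]; exact c1
      rw [smul_add, smul_add, this, mul_smul, two_smul, sub_smul]
      abel
    have e2 := congrArg ueNr e
    rw [ueNr_smul, ← hN] at e2
    have e3 := ue_nr_add ((2 * ap) • qp) ((ap - am) • p)
    rw [ueNr_smul, ueNr_smul] at e3
    have e4 : |2 * ap| ≤ 4 := by rw [abs_mul, abs_two]; linarith
    have e5 : |ap - am| ≤ 4 * lam * (L * N) := by
      have : ap - am = 2 * lam * ((u t (x + η) - u t x) - (u t (x + -η) - u t x)) := by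
        rw [hap, ham]; ring
      rw [this, abs_mul, abs_of_nonneg (by linarith : 0 ≤ 2 * lam)]
      have := abs_sub (u t (x + η) - u t x) (u t (x + -η) - u t x)
      have := mul_le_mul_of_nonneg_left (this.trans (add_le_add hvp hvm)) (by linarith : 0 ≤ 2 * lam)
      linarith
    have e6 := mul_le_mul_of_nonneg_right e4 (ueNr_nonneg qp)
    have e7 : |ap - am| * ueNr p ≤ 4 * lam * (L * N) * L := by
      apply mul_le_mul e5 (by rw [hp]; exact hgL x) (ueNr_nonneg _) (by positivity)
    have e8 : |2 * K| = 2 * K := abs_of_nonneg (by positivity)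
    rw [e8] at e2
    have e9 : 2 * K * N = 2 * K' * N + 4 * lam * (L * N) * L := by rw [hK]; ring
    linarith
  have low2 : (K' * N) ^ 2 ≤ 4 * sqnorm qp := by
    rw [← ueNr_sq]
    have h1 : K' * N ≤ 2 * ueNr qp := by linarith
    have h2 : (K' * N) ^ 2 ≤ (2 * ueNr qp) ^ 2 := by gcongr
    linarith
  have hQm0 := ue_sqnorm_nonneg qm
  have f1 : 2 * sqnorm qp ≤ ε + C2 * N ^ 2 := by
    rw [hlam] at fin
    linarith
  have hKsq : 2 * C2 + 2 ≤ K' ^ 2 := by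
    have h1 : 1 ≤ K' := by
      have : 0 ≤ lam * L ^ 2 := by positivity
      linarith
    have : 0 ≤ lam * L ^ 2 := by positivity
    nlinarith
  have := mul_le_mul_of_nonneg_right hKsq (sq_nonneg N)
  rw [mul_pow] at low2
  linarith

/-- Step 3: bound on the second derivatives. -/
lemma ue_step3 {d : ℕ} (S : MFGSetting d) : ∃ K, 0 ≤ K ∧ ∀ δ u m, UeSol S δ u m →
    ∀ t, 0 ≤ t → ∀ x v w, |D2 (u t) x v w| ≤ K * ‖v‖ * ‖w‖ := by
  obtain ⟨L, hL, hLip⟩ := ue_step2 S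
  obtain ⟨CH, hCH, hT⟩ := ue_H_taylor S L
  obtain ⟨lam, hlam⟩ : ∃ lam, lam = CH + 1 := ⟨_, rfl⟩
  obtain ⟨C2, hC2⟩ : ∃ C2, C2 = 4 * lam * L * CH + 4 * CH + 4 * lam * L * (d * |S.CF|) + 4 * |S.CF| :=
    ⟨_, rfl⟩
  obtain ⟨K', hK'⟩ : ∃ K', K' = 2 * L + 8 * lam * L ^ 2 + 2 * C2 + 2 := ⟨_, rfl⟩
  have hlam0 : 0 < lam := by linarith
  have hC20 : 0 ≤ C2 := by rw [hC2]; positivity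
  have hK'0 : 0 < K' := by rw [hK']; positivity
  have hK'L : 2 * L ≤ K' := by
    have : 0 ≤ lam * L ^ 2 := by positivity
    linarith
  obtain ⟨K, hK⟩ : ∃ K, K = K' + 2 * lam * L ^ 2 := ⟨_, rfl⟩
  have hK0 : 0 < K := by rw [hK]; positivity
  refine ⟨2 * (K * d), by positivity, fun δ u m h => ?_⟩
  have hLip := hLip δ u m h
  have main : ∀ s : ℝ, |s| = 1 → ∀ t, 0 ≤ t → ∀ x η : Vd d,
      ueV (u t) s lam x η + ueV (u t) s lam x (-η) - K * sqnorm η ≤ 0 := by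
    intro s hs t0 ht0 x0 η0
    by_contra hcon
    push Not at hcon
    obtain ⟨a, ha⟩ : ∃ a, a = ueV (u t0) s lam x0 η0 + ueV (u t0) s lam x0 (-η0) - K * sqnorm η0 :=
      ⟨_, rfl⟩
    rw [← ha] at hcon
    have up : ∀ t, 0 ≤ t → ∀ x η : Vd d,
        ueV (u t) s lam x η + ueV (u t) s lam x (-η) - K * sqnorm η ≤
        2 * L * ueNr η - K' * ueNr η ^ 2 := by
      intro t ht x η
      have h1 := ueV_le (hLip t ht) hs hlam0.le x η
      have h2 := ueV_le (hLip t ht) hs hlam0.le x (-η)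
      rw [ueNr_neg] at h2
      rw [← ueNr_sq, hK]
      linarith
    obtain ⟨ε, hε⟩ : ∃ ε, ε = min (a / (2 * (t0 + 1))) (a ^ 2 / (32 * L ^ 2)) := ⟨_, rfl⟩
    have hεpos : 0 < ε := by rw [hε]; exact lt_min (by positivity) (by positivity)
    have hε2 : ε * t0 ≤ a / 2 := by
      have : ε ≤ a / (2 * (t0 + 1)) := by rw [hε]; exact min_le_left _ _
      calc ε * t0 ≤ ε * (t0 + 1) := by nlinarith
        _ ≤ a / (2 * (t0 + 1)) * (t0 + 1) := by gcongr
        _ = a / 2 := by field_simp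
    have hε3 : ε * (32 * L ^ 2) ≤ a ^ 2 := by
      have : ε ≤ a ^ 2 / (32 * L ^ 2) := by rw [hε]; exact min_le_right _ _
      rwa [le_div_iff₀ (by positivity)] at this
    obtain ⟨t, ht, ⟨x, η⟩, -, hmax⟩ := ue_max (E := Vd d × Vd d)
      (fun t e => ueV (u t) s lam e.1 e.2 + ueV (u t) s lam e.1 (-e.2) - K * sqnorm e.2)
      (by
        have k1 := h.contE (continuous_fst : Continuous fun e : Vd d × Vd d => e.1)
        have k2 := h.contE (by fun_prop : Continuous fun e : Vd d × Vd d => e.1 + e.2)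
        have k3 := h.contE (by fun_prop : Continuous fun e : Vd d × Vd d => e.1 + -e.2)
        have k4 : Continuous fun e : Vd d × Vd d => sqnorm e.2 := by unfold sqnorm; fun_prop
        unfold ueV
        refine ContinuousOn.sub (ContinuousOn.add ?_ ?_)
          (continuousOn_const.mul (k4.comp continuous_snd).continuousOn)
        · exact (continuousOn_const.mul (k2.sub k1)).add (continuousOn_const.mul ((k2.sub k1).pow 2))
        · exact (continuousOn_const.mul (k3.sub k1)).add (continuousOn_const.mul ((k3.sub k1).pow 2)))
      1 (2 * L)
      (fun t ht e => by
        by_cases he : ‖e.2‖ ≤ 1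
        · obtain ⟨z, hz⟩ := ue_red e.1
          refine ⟨(e.1 + intVec z, e.2), by simp [Prod.norm_mk, hz, he], ?_⟩
          simp only [ueV, add_right_comm e.1 (intVec z), h.per t ht, le_refl]
        · push Not at he
          refine ⟨0, by simp, ?_⟩
          have h1 := up t ht e.1 e.2
          have h2 : 1 ≤ ueNr e.2 := he.le.trans (ue_norm_le_nr _)
          have h3 : 2 * L * ueNr e.2 - K' * ueNr e.2 ^ 2 ≤ 0 := by
            have : 2 * L * ueNr e.2 ≤ K' * ueNr e.2 := by gcongr
            have : K' * ueNr e.2 ≤ K' * (ueNr e.2 * ueNr e.2) := by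
              gcongr
              nlinarith
            nlinarith
          have h4 : ueV (u t) s lam (0 : Vd d × Vd d).1 (0 : Vd d × Vd d).2 +
            ueV (u t) s lam (0 : Vd d × Vd d).1 (-(0 : Vd d × Vd d).2) -
            K * sqnorm (0 : Vd d × Vd d).2 = 0 := by simp [ueV, sqnorm]
          rw [h4]
          linarith)
      (fun t ht e => by
        have h1 := up t ht e.1 e.2
        have h2 := ueNr_nonneg e.2
        refine h1.trans ?_
        by_cases he : ueNr e.2 ≤ 1
        · have : 0 ≤ K' * ueNr e.2 ^ 2 := by positivity
          nlinarith
        · push Not at he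
          have : 2 * L * ueNr e.2 ≤ K' * ueNr e.2 := by gcongr
          have : K' * ueNr e.2 ≤ K' * (ueNr e.2 * ueNr e.2) := by
            gcongr
            nlinarith
          nlinarith) ε hεpos
    have hval : a / 2 ≤ ueV (u t) s lam x η + ueV (u t) s lam x (-η) - K * sqnorm η := by
      have h1 := hmax t0 ht0 (x0, η0)
      have h2 : 0 ≤ ε * t := by positivity
      simp only at h1
      rw [← ha] at h1
      linarith
    have h3 := ue_step3_pt S hL hCH hT h hLip hs hlam hC2 hK' (ε := ε) ht x η
      (by rw [← hK]; linarith)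
      (fun r hr y k => by rw [← hK]; exact hmax r hr (y, k))
    have h4 := up t ht x η
    have h5 := ueNr_nonneg η
    have h6 : a / 2 ≤ 2 * L * ueNr η := by
      have : 0 ≤ K' * ueNr η ^ 2 := by positivity
      linarith
    have h7 : (a / 2) ^ 2 ≤ (2 * L * ueNr η) ^ 2 := by gcongr
    have h8 : L ^ 2 * ueNr η ^ 2 ≤ L ^ 2 * ε := by gcongr
    have : 0 < a ^ 2 := by positivity
    nlinarith
  have diag : ∀ t, 0 ≤ t → ∀ x v, |D2 (u t) x v v| ≤ K * d * ‖v‖ ^ 2 := by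
    intro t ht x v
    have one : ∀ s : ℝ, |s| = 1 → s * D2 (u t) x v v ≤ K * sqnorm v := by
      intro s hs
      refine le_of_tendsto ((ue_sd (h.sm t ht) x v).const_mul s) ?_
      filter_upwards [self_mem_nhdsWithin] with τ hτ
      have hτ' : (0:ℝ) < τ := hτ
      have h1 := main s hs t ht x (τ • v)
      rw [ue_sqnorm_smul] at h1
      simp only [ueV] at h1
      have h2 : 0 ≤ lam * (u t (x + τ • v) - u t x) ^ 2 := by positivity
      have h3 : 0 ≤ lam * (u t (x + -(τ • v)) - u t x) ^ 2 := by positivity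
      rw [neg_smul, ← mul_div_assoc, div_le_iff₀ (by positivity)]
      linarith
    have h1 := one 1 (by simp)
    have h2 := one (-1) (by simp)
    have h3 := mul_le_mul_of_nonneg_left (ue_sqnorm_le v) hK0.le
    rw [abs_le]
    constructor <;> linarith
  intro t ht x v w
  have := ue_D2_polar (h.sm t ht) x (diag t ht x) v w
  exact this

lemma ue_norm_single {d : ℕ} (i : Fin d) : ‖(Pi.single i 1 : Vd d)‖ = 1 := by
  have h := Pi.norm_single (G := fun _ : Fin d => ℝ) (i := i) (1 : ℝ)
  simpa using h

/-- Step 4: bound on the time derivative. -/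
lemma ue_step4 {d : ℕ} (S : MFGSetting d) : ∃ C, 0 ≤ C ∧ ∀ δ u m, UeSol S δ u m →
    ∀ t, 0 ≤ t → ∀ x, |tderiv u t x| ≤ C := by
  obtain ⟨L, hL, hLip⟩ := ue_step2 S
  obtain ⟨K, hK, hD2⟩ := ue_step3 S
  obtain ⟨A, hA, hu⟩ := ue_step0 S
  obtain ⟨CH, hCH, hH⟩ := ue_H_bdd S L
  obtain ⟨MF, hMF⟩ := S.Fd_bounded
  refine ⟨d * K + A + CH + |MF|, by positivity, fun δ u m h t ht x => ?_⟩
  have e := h.eqn t ht x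
  have hl : |lapl (u t) x| ≤ d * K := by
    rw [lapl]
    refine (Finset.abs_sum_le_sum_abs _ _).trans ?_
    have : ∀ i ∈ Finset.univ, |D2 (u t) x (Pi.single i 1) (Pi.single i 1)| ≤ K := by
      intro i _
      have := hD2 δ u m h t ht x (Pi.single i 1) (Pi.single i 1)
      rwa [ue_norm_single, mul_one, mul_one] at this
    refine (Finset.sum_le_sum this).trans ?_
    simp
  have h1 := abs_le.1 hl
  have h2 := abs_le.1 (hu δ u m h t ht x)
  have h3 := abs_le.1 (hH x (gradv (u t) x) ((ue_norm_le_nr _).trans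
    (ue_grad_le (h.diff ht) (by linarith) (hLip δ u m h t ht) x)))
  have h4 := abs_le.1 ((hMF (m t) x).trans (le_abs_self _))
  rw [abs_le]
  constructor <;> linarith

lemma ue_DpH {d : ℕ} (S : MFGSetting d) (P : ℝ) :
    ∃ C, 0 ≤ C ∧ ∀ x p, ‖p‖ ≤ P → ueNr (DpH S x p) ≤ C := by
  set G := fun q : Vd d × Vd d => S.H q.1 q.2 with hG
  have hcomp : IsCompact (Metric.closedBall (0 : Vd d) 1 ×ˢ Metric.closedBall (0 : Vd d) P) :=
    (isCompact_closedBall 0 1).prod (isCompact_closedBall 0 P)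
  have hd1 : Continuous (fderiv ℝ G) := S.H_smooth.continuous_fderiv (by norm_num)
  obtain ⟨C, hC⟩ := hcomp.exists_bound_of_continuousOn hd1.continuousOn
  refine ⟨(d + 1) * |C|, by positivity, fun x p hp => ?_⟩
  obtain ⟨z, hz⟩ := ue_red x
  have e1 : DpH S x p = DpH S (x + intVec z) p := by
    ext i
    simp only [DpH, S.H_per]
  rw [e1]
  refine (ue_nr_le _).trans ?_
  gcongr
  rw [pi_norm_le_iff_of_nonneg (abs_nonneg _)]
  intro i
  have hdG : DifferentiableAt ℝ G (x + intVec z, p) := S.H_smooth.differentiable (by norm_num) _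
  have e2 : DpH S (x + intVec z) p i = fderiv ℝ G (x + intVec z, p) (0, Pi.single i 1) := by
    have h1 : HasFDerivAt (fun p' : Vd d => ((x + intVec z, p') : Vd d × Vd d))
      (ContinuousLinearMap.inr ℝ (Vd d) (Vd d)) p := hasFDerivAt_prodMk_right _ _
    have h2 := hdG.hasFDerivAt.comp p h1
    have h3 : fderiv ℝ (fun p' => S.H (x + intVec z) p') p = _ := h2.fderiv
    rw [DpH, h3]
    simp
  rw [e2]
  have := hC (x + intVec z, p) ⟨by simpa using hz, by simpa using hp⟩
  refine (ContinuousLinearMap.le_opNorm _ _).trans ?_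
  have h5 : ‖((0 : Vd d), (Pi.single i 1 : Vd d))‖ = 1 := by simp [Prod.norm_mk, ue_norm_single]
  rw [h5, mul_one]
  exact this.trans (le_abs_self _)

lemma ue_conv_lip {d : ℕ} {W : Type*} [NormedAddCommGroup W] [NormedSpace ℝ W] {ψ : Vd d → W}
    (hψ : Continuous ψ) (hc : HasCompactSupport ψ) {f : Vd d → ℝ} (hfc : Continuous f)
    (hf : ∀ x y, |f x - f y| ≤ ‖x - y‖) (x x' : Vd d) :
    ‖(∫ y, f (x - y) • ψ y) - ∫ y, f (x' - y) • ψ y‖ ≤ (∫ y, ‖ψ y‖) * ‖x - x'‖ := by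
  have hi : ∀ x, Integrable (fun y => f (x - y) • ψ y) := fun x => by
    refine Continuous.integrable_of_hasCompactSupport (by fun_prop) ?_
    exact hc.smul_left
  rw [← integral_sub (hi x) (hi x'), ← integral_mul_const]
  refine norm_integral_le_of_norm_le ?_ (Eventually.of_forall fun y => ?_)
  · exact (Continuous.integrable_of_hasCompactSupport hψ.norm hc.norm).mul_const _
  · rw [← sub_smul, norm_smul, mul_comm]
    gcongr
    have := hf (x - y) (x' - y)
    rwa [sub_sub_sub_cancel_right] at this

lemma ue_lip_fderiv {d : ℕ} {G : Vd d → ℝ} {C : ℝ} (hC : 0 ≤ C)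
    (h : ∀ x y, |G x - G y| ≤ C * ‖x - y‖) (x w : Vd d) : |fderiv ℝ G x w| ≤ C * ‖w‖ := by
  have h1 : LipschitzWith ⟨C, hC⟩ G := LipschitzWith.of_dist_le_mul fun x y => by
    rw [Real.dist_eq, dist_eq_norm]; exact h x y
  have h2 := norm_fderiv_le_of_lipschitz ℝ h1 (x₀ := x)
  rw [← Real.norm_eq_abs]
  refine ((fderiv ℝ G x).le_opNorm w).trans ?_
  gcongr
  exact h2

lemma ue_moll1 (d : ℕ) : ∃ C, 0 ≤ C ∧ ∀ f : Vd d → ℝ, (∀ x y, |f x - f y| ≤ ‖x - y‖) →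
    ∃ g : Vd d → ℝ, ContDiff ℝ 2 g ∧ (∀ x, |g x - f x| ≤ 1) ∧
      (∀ x y, |g x - g y| ≤ ‖x - y‖) ∧ (∀ v x y, |fderiv ℝ g x v - fderiv ℝ g y v| ≤ C * ‖v‖ * ‖x - y‖) ∧
      ∀ a, (∀ x, f (x + a) = f x) → ∀ x, g (x + a) = g x := by
  let φ : ContDiffBump (0 : Vd d) := ⟨1/2, 1, by norm_num, by norm_num⟩
  obtain ⟨ψ, hψ⟩ : ∃ ψ : Vd d → ℝ, ψ = φ.normed volume := ⟨_, rfl⟩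
  have hψs : ContDiff ℝ 2 ψ := by rw [hψ]; exact_mod_cast φ.contDiff_normed (n := 2)
  have hψc : HasCompactSupport ψ := by rw [hψ]; exact φ.hasCompactSupport_normed
  have hψ0 : ∀ y, 0 ≤ ψ y := by rw [hψ]; exact φ.nonneg_normed
  have hψ1 : ∫ y, ψ y = 1 := by rw [hψ]; exact φ.integral_normed
  refine ⟨∫ y, ‖fderiv ℝ ψ y‖, by positivity, fun f hf => ?_⟩
  have hfc : Continuous f := by
    have : LipschitzWith 1 f := LipschitzWith.of_dist_le_mul fun x y => by
      rw [Real.dist_eq, dist_eq_norm]; simpa using hf x y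
    exact this.continuous
  have hli : LocallyIntegrable f := hfc.locallyIntegrable
  obtain ⟨g, hg⟩ : ∃ g : Vd d → ℝ, g = convolution ψ f (ContinuousLinearMap.lsmul ℝ ℝ) volume :=
    ⟨_, rfl⟩
  have hgf : ∀ x, g x = ∫ y, f (x - y) • ψ y := by
    intro x
    rw [hg]
    simp only [convolution, ContinuousLinearMap.lsmul_apply, smul_eq_mul, mul_comm]
  have hgd : ∀ x, fderiv ℝ g x = ∫ y, f (x - y) • fderiv ℝ ψ y := by
    intro x
    have := (hψc.hasFDerivAt_convolution_left (ContinuousLinearMap.lsmul ℝ ℝ)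
      (hψs.of_le (by norm_num)) hli x).fderiv
    rw [hg, this, convolution]
    congr 1
    ext y v
    simp [ContinuousLinearMap.precompL_apply, mul_comm]
  refine ⟨g, ?_, ?_, ?_, ?_, ?_⟩
  · rw [hg]
    exact_mod_cast hψc.contDiff_convolution_left (n := 2) (ContinuousLinearMap.lsmul ℝ ℝ)
      (by exact_mod_cast hψs) hli
  · intro x
    have := φ.dist_normed_convolution_le (μ := volume) (g := f) (x₀ := x) (ε := 1)
      hfc.aestronglyMeasurable (fun y hy => by
        rw [Real.dist_eq]
        refine (hf y x).trans ?_
        have : dist y x < 1 := hy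
        rw [dist_eq_norm] at this
        exact this.le)
    rw [hg, hψ]
    rwa [Real.dist_eq] at this
  · intro x y
    have := ue_conv_lip hψs.continuous hψc hfc hf x y
    rw [← hgf, ← hgf] at this
    have e : ∫ y, ‖ψ y‖ = 1 := by
      rw [← hψ1]; congr 1; ext y; rw [Real.norm_eq_abs, abs_of_nonneg (hψ0 y)]
    rw [e, one_mul] at this
    exact this
  · intro v x y
    have := ue_conv_lip (hψs.continuous_fderiv (by norm_num)) (hψc.fderiv ℝ) hfc hf x y
    rw [← hgd, ← hgd] at this
    have h2 := (fderiv ℝ g x - fderiv ℝ g y).le_opNorm v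
    rw [_root_.sub_apply, Real.norm_eq_abs] at h2
    refine h2.trans ((mul_le_mul_of_nonneg_right this (norm_nonneg v)).trans (le_of_eq ?_))
    ring
  · intro a ha x
    rw [hgf, hgf]
    congr 1
    ext y
    rw [add_sub_right_comm, ha]

lemma ue_moll (d : ℕ) : ∃ C, 0 ≤ C ∧ ∀ ρ : ℝ, 0 < ρ → ∀ f : Vd d → ℝ, (∀ x y, |f x - f y| ≤ ‖x - y‖) →
    (∀ (x : Vd d) (z : Fin d → ℤ), f (x + intVec z) = f x) →
    ∃ g : Vd d → ℝ, ContDiff ℝ 2 g ∧ (∀ x, |g x - f x| ≤ ρ) ∧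
      (∀ x v, |fderiv ℝ g x v| ≤ ‖v‖) ∧ (∀ x v w, |D2 g x v w| ≤ C / ρ * ‖v‖ * ‖w‖) ∧
      ∀ (x : Vd d) (z : Fin d → ℤ), g (x + intVec z) = g x := by
  obtain ⟨C, hC, hm⟩ := ue_moll1 d
  refine ⟨C, hC, fun ρ hρ f hf hper => ?_⟩
  obtain ⟨g, g1, g2, g3, g4, g5⟩ := hm (fun x => ρ⁻¹ * f (ρ • x)) (fun x y => by
    rw [← mul_sub, abs_mul, abs_of_pos (inv_pos.2 hρ), inv_mul_le_iff₀ hρ]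
    refine (hf _ _).trans ?_
    rw [← smul_sub, norm_smul, Real.norm_eq_abs, abs_of_pos hρ])
  have hG : ContDiff ℝ 2 (fun x : Vd d => ρ * g (ρ⁻¹ • x)) :=
    contDiff_const.mul (g1.comp (contDiff_const_smul ρ⁻¹))
  have hn : ∀ x y : Vd d, ‖ρ⁻¹ • x - ρ⁻¹ • y‖ = ρ⁻¹ * ‖x - y‖ := fun x y => by
    rw [← smul_sub, norm_smul, Real.norm_eq_abs, abs_of_pos (inv_pos.2 hρ)]
  have hfd : ∀ x v, fderiv ℝ (fun x : Vd d => ρ * g (ρ⁻¹ • x)) x v = fderiv ℝ g (ρ⁻¹ • x) v := by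
    intro x v
    have hd : DifferentiableAt ℝ (fun x : Vd d => g (ρ⁻¹ • x)) x :=
      (g1.comp (contDiff_const_smul ρ⁻¹)).differentiable (by norm_num) x
    rw [fderiv_const_mul hd, fderiv_comp_smul]
    simp only [_root_.smul_apply, smul_eq_mul]
    field_simp
  refine ⟨fun x => ρ * g (ρ⁻¹ • x), hG, ?_, ?_, ?_, ?_⟩
  · intro x
    have := g2 (ρ⁻¹ • x)
    rw [smul_smul, mul_inv_cancel₀ hρ.ne', one_smul] at this
    have e : ρ * g (ρ⁻¹ • x) - f x = ρ * (g (ρ⁻¹ • x) - ρ⁻¹ * f x) := by field_simp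
    rw [e, abs_mul, abs_of_pos hρ]
    nlinarith
  · intro x v
    have := ue_lip_fderiv (C := 1) zero_le_one (fun x y => by simpa using g3 x y) (ρ⁻¹ • x) v
    rw [hfd]; simpa using this
  · intro x v w
    rw [D2]
    refine ue_lip_fderiv (by positivity) (fun x y => ?_) x w
    rw [hfd, hfd]
    refine (g4 v _ _).trans (le_of_eq ?_)
    rw [hn]; field_simp
  · intro x z
    have := g5 (ρ⁻¹ • intVec z) (fun x => by
      rw [smul_add, smul_smul, mul_inv_cancel₀ hρ.ne', one_smul, hper]) (ρ⁻¹ • x)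
    simp only [smul_add, this]

lemma ue_secT_meas {d : ℕ} : Measurable (secT : Td d → Vd d) := by
  refine measurable_pi_lambda _ fun i => ?_
  exact (measurable_subtype_coe.comp
    (AddCircle.measurableEquivIco (1 : ℝ) 0).measurable).comp (measurable_pi_apply i)

lemma ue_secT_norm {d : ℕ} (y : Td d) : ‖secT y‖ ≤ 1 := by
  rw [pi_norm_le_iff_of_nonneg zero_le_one]
  intro i
  have := ((AddCircle.equivIco (1 : ℝ) 0) (y i)).2
  rw [secT, Real.norm_eq_abs, abs_of_nonneg this.1]
  linarith [this.2]

/-- periodic lift -/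
def ueLift {d : ℕ} (φ : Td d → ℝ) : Vd d → ℝ := fun x => φ (fun i => (x i : AddCircle (1 : ℝ)))

lemma ueLift_secT {d : ℕ} (φ : Td d → ℝ) (y : Td d) : ueLift φ (secT y) = φ y := by
  unfold ueLift
  congr 1
  ext i
  exact AddCircle.coe_equivIco

lemma ueLift_per {d : ℕ} (φ : Td d → ℝ) (x : Vd d) (z : Fin d → ℤ) :
    ueLift φ (x + intVec z) = ueLift φ x := by
  unfold ueLift
  congr 1
  ext i
  simp only [Pi.add_apply, intVec, AddCircle.coe_add, add_eq_left]
  have := AddCircle.coe_eq_zero_iff (1 : ℝ) (x := (z i : ℝ))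
  exact this.2 ⟨z i, by simp⟩

lemma ueLift_lip {d : ℕ} {φ : Td d → ℝ} (h : LipschitzWith 1 φ) (x y : Vd d) :
    |ueLift φ x - ueLift φ y| ≤ ‖x - y‖ := by
  have h1 := h.dist_le_mul (fun i => (x i : AddCircle (1 : ℝ))) (fun i => (y i : AddCircle (1 : ℝ)))
  rw [Real.dist_eq] at h1
  refine h1.trans ?_
  rw [NNReal.coe_one, one_mul, dist_pi_le_iff (norm_nonneg _)]
  intro i
  rw [dist_eq_norm, ← AddCircle.coe_sub]
  exact (QuotientAddGroup.norm_mk_le_norm (m := x i - y i)).trans (norm_le_pi_norm (x - y) i)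

lemma ue_lapl_le {d : ℕ} {g : Vd d → ℝ} {K : ℝ} (h : ∀ x v w, |D2 g x v w| ≤ K * ‖v‖ * ‖w‖) (x) :
    |lapl g x| ≤ d * K := by
  rw [lapl]
  refine (Finset.abs_sum_le_sum_abs _ _).trans ?_
  have : ∀ i ∈ Finset.univ, |D2 g x (Pi.single i 1) (Pi.single i 1)| ≤ K := by
    intro i _
    have := h x (Pi.single i 1) (Pi.single i 1)
    rwa [ue_norm_single, mul_one, mul_one] at this
  refine (Finset.sum_le_sum this).trans ?_
  simp

lemma ue_int_bdd {d : ℕ} (μ : PTd d) {f : Td d → ℝ} {C : ℝ} (h : ∀ y, |f y| ≤ C) :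
    |∫ y, f y ∂(μ : Measure (Td d))| ≤ C := by
  have := norm_integral_le_of_norm_le_const (μ := (μ : Measure (Td d))) (f := f) (C := C)
    (Eventually.of_forall h)
  simpa using this

lemma ue_int_sub {d : ℕ} (μ : PTd d) {f g : Td d → ℝ} (hf : Measurable f) (hg : Measurable g)
    {B C : ℝ} (hB : ∀ y, |f y| ≤ B) (h : ∀ y, |g y - f y| ≤ C) :
    |(∫ y, g y ∂(μ : Measure (Td d))) - ∫ y, f y ∂(μ : Measure (Td d))| ≤ C := by
  have hfi : Integrable f (μ : Measure (Td d)) :=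
    Integrable.of_bound hf.aestronglyMeasurable B (Eventually.of_forall hB)
  have hgi : Integrable g (μ : Measure (Td d)) :=
    Integrable.of_bound hg.aestronglyMeasurable (B + C) (Eventually.of_forall fun y => by
      have h1 := hB y
      have h2 := h y
      rw [Real.norm_eq_abs]
      calc |g y| = |f y + (g y - f y)| := by ring_nf
        _ ≤ _ := (abs_add_le _ _).trans (by linarith))
  rw [← integral_sub hgi hfi]
  exact ue_int_bdd μ h

/-- Step 5, ordered times. -/
lemma ue_step5 {d : ℕ} (S : MFGSetting d) : ∃ C, 0 ≤ C ∧ ∀ δ u m, UeSol S δ u m →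
    (∀ s₁ s₂ : ℝ, 0 ≤ s₁ → s₁ ≤ s₂ →
      FPeq 1 m (fun s y => DpH S (secT y) (gradv (u s) (secT y))) s₁ s₂) →
    ∀ φ : Td d → ℝ, LipschitzWith 1 φ → ∀ s l, 0 ≤ s → s ≤ l →
    |(∫ y, φ y ∂(m l : Measure (Td d))) - ∫ y, φ y ∂(m s : Measure (Td d))| ≤ C * √(l - s) := by
  obtain ⟨L, hL, hLip⟩ := ue_step2 S
  obtain ⟨CD, hCD, hD⟩ := ue_DpH S L
  obtain ⟨CM, hCM, hM⟩ := ue_moll d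
  refine ⟨2 + (d * CM + CD * (d + 1)), by positivity, fun δ u m h hFP φ hφ s l hs hsl => ?_⟩
  set f := ueLift φ with hf
  have hfl := ueLift_lip hφ
  have hfs := ueLift_secT φ
  have hφm : Measurable φ := hφ.continuous.measurable
  have hφb : ∀ y, |φ y - f 0| ≤ 1 := fun y => by
    rw [← hfs y]
    have := hfl (secT y) 0
    rw [sub_zero] at this
    exact this.trans (ue_secT_norm y)
  have hφB : ∀ y, |φ y| ≤ |f 0| + 1 := fun y => by
    have := hφb y
    calc |φ y| = |f 0 + (φ y - f 0)| := by ring_nf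
      _ ≤ _ := (abs_add_le _ _).trans (by linarith)
  rcases eq_or_lt_of_le hsl with rfl | hlt
  · simp
  have hτ : 0 < l - s := sub_pos.2 hlt
  set ρ := √(l - s) with hρ
  have hρ0 : 0 < ρ := Real.sqrt_pos.2 hτ
  have hρ2 : ρ * ρ = l - s := Real.mul_self_sqrt hτ.le
  rcases le_total ρ 1 with h1 | h1
  · obtain ⟨g, hg, hgf, hg1, hg2, hgp⟩ := hM ρ hρ0 f hfl (fun x z => ueLift_per φ x z)
    have hgm : Measurable fun y : Td d => g (secT y) := hg.continuous.measurable.comp ue_secT_meas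
    have hc : ∀ μ : PTd d, |(∫ y, g (secT y) ∂(μ : Measure (Td d))) -
        ∫ y, φ y ∂(μ : Measure (Td d))| ≤ ρ := fun μ =>
      ue_int_sub μ hφm hgm hφB fun y => by rw [← hfs y]; exact hgf _
    have key := hFP s l hs hsl (fun _ => g) ⟨hg.comp contDiff_snd, fun _ => hgp⟩
    have hR : |∫ s' in s..l, ∫ y, (tderiv (fun _ : ℝ => g) s' (secT y) + 1 * lapl g (secT y)
        - dotp (DpH S (secT y) (gradv (u s') (secT y))) (gradv g (secT y)))
          ∂(m s' : Measure (Td d))| ≤ (d * (CM / ρ) + CD * (d + 1)) * |l - s| := by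
      rw [← Real.norm_eq_abs]
      refine intervalIntegral.norm_integral_le_of_norm_le_const fun r hr => ?_
      rw [uIoc_of_le hsl] at hr
      have hr0 : 0 ≤ r := by linarith [hr.1]
      refine ue_int_bdd _ fun y => ?_
      have e1 : tderiv (fun _ : ℝ => g) r (secT y) = 0 := by simp [tderiv]
      have e2 := ue_lapl_le hg2 (secT y)
      have e3 : |dotp (DpH S (secT y) (gradv (u r) (secT y))) (gradv g (secT y))|
          ≤ CD * (d + 1) := by
        refine (ue_dotp_le _ _).trans ?_
        have a1 := hD (secT y) (gradv (u r) (secT y)) ((ue_norm_le_nr _).trans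
          (ue_grad_le (h.diff hr0) (by linarith) (hLip δ u m h r hr0) _))
        have a2 : ‖gradv g (secT y)‖ ≤ 1 := by
          rw [pi_norm_le_iff_of_nonneg zero_le_one]
          intro i
          have := hg1 (secT y) (Pi.single i 1)
          rwa [ue_norm_single] at this
        have a3 : ueNr (gradv g (secT y)) ≤ d + 1 := by
          refine (ue_nr_le _).trans ?_
          exact mul_le_of_le_one_right (by positivity) a2
        exact mul_le_mul a1 a3 (ueNr_nonneg _) hCD
      rw [e1, zero_add, one_mul]
      exact (abs_sub _ _).trans (add_le_add e2 e3)
    rw [← key, abs_of_pos hτ, ← hρ2] at hR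
    have hk : (d * (CM / ρ) + CD * (d + 1)) * (ρ * ρ) ≤ (d * CM + CD * (d + 1)) * ρ := by
      have : (d * (CM / ρ) + CD * (d + 1)) * (ρ * ρ) = (d * CM + CD * (d + 1) * ρ) * ρ := by
        field_simp
      rw [this]
      refine mul_le_mul_of_nonneg_right (add_le_add le_rfl ?_) hρ0.le
      exact mul_le_of_le_one_right (by positivity) h1
    have b1 := abs_le.1 (hc (m l))
    have b2 := abs_le.1 (hc (m s))
    have b3 := abs_le.1 (hR.trans hk)
    rw [abs_le]
    constructor <;> linarith [b1.1, b1.2, b2.1, b2.2, b3.1, b3.2]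
  · have hc : ∀ μ : PTd d, |(∫ y, φ y ∂(μ : Measure (Td d))) - f 0| ≤ 1 := fun μ => by
      have := ue_int_sub μ (f := fun _ => f 0) measurable_const hφm (fun _ => le_rfl) hφb
      simpa using this
    have b1 := abs_le.1 (hc (m l))
    have b2 := abs_le.1 (hc (m s))
    have : 2 * 1 ≤ (2 + (d * CM + CD * (d + 1))) * ρ := by
      have : (0 : ℝ) ≤ d * CM + CD * (d + 1) := by positivity
      exact mul_le_mul (by linarith) h1 zero_le_one (by linarith)
    rw [abs_le]
    constructor <;> linarith [b1.1, b1.2, b2.1, b2.2]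

lemma ue_W1 {d : ℕ} {μ ν : PTd d} {B : ℝ}
    (h : ∀ φ : Td d → ℝ, LipschitzWith 1 φ →
      (∫ y, φ y ∂(μ : Measure (Td d))) - ∫ y, φ y ∂(ν : Measure (Td d)) ≤ B) : W1 μ ν ≤ B := by
  refine csSup_le ⟨_, fun _ => (0 : ℝ), LipschitzWith.const' 0, rfl⟩ ?_
  rintro r ⟨φ, hφ, rfl⟩
  exact h φ hφ

theorem ue_final (d : ℕ) (S : MFGSetting d) :
    ∃ C : ℝ, 0 < C ∧ ∀ δ : ℝ, 0 < δ → ∀ (u : ℝ → Vd d → ℝ) (m : ℝ → PTd d),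
      SolvesDiscMFG S δ u m →
      (∃ M : ℝ, ∀ t ∈ Set.Ici (0:ℝ), ∀ x : Vd d, |u t x| ≤ M) →
      ((∀ t ∈ Set.Ici (0:ℝ), ∀ x : Vd d, Real.sqrt (sqnorm (gradv (u t) x)) ≤ C) ∧
       (∀ t ∈ Set.Ici (0:ℝ), ∀ x v w : Vd d, |D2 (u t) x v w| ≤ C * ‖v‖ * ‖w‖) ∧
       (∀ s ∈ Set.Ici (0:ℝ), ∀ l ∈ Set.Ici (0:ℝ), W1 (m s) (m l) ≤ C * Real.sqrt |l - s|) ∧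
       (∀ t ∈ Set.Ici (0:ℝ), ∀ x : Vd d, |tderiv u t x| ≤ C)) := by
  obtain ⟨L, hL, hLip⟩ := ue_step2 S
  obtain ⟨K, hK, hD2⟩ := ue_step3 S
  obtain ⟨Ct, hCt, ht'⟩ := ue_step4 S
  obtain ⟨CW, hCW, hW⟩ := ue_step5 S
  refine ⟨L + K + Ct + CW, by linarith, fun δ hδ u m hs hb => ?_⟩
  have h := ue_sol hδ hs hb
  refine ⟨fun t ht x => ?_, fun t ht x v w => ?_, fun s hs0 l hl0 => ?_, fun t ht x => ?_⟩
  · have : ueNr (gradv (u t) x) ≤ L :=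
      ue_grad_le (h.diff ht) (by linarith) (hLip δ u m h t ht) x
    rw [ueNr] at this
    linarith
  · refine (hD2 δ u m h t ht x v w).trans ?_
    gcongr
    linarith
  · refine ue_W1 fun φ hφ => ?_
    have hle : CW * √|l - s| ≤ (L + K + Ct + CW) * √|l - s| := by
      gcongr
      linarith
    refine le_trans ?_ hle
    rcases le_total s l with hsl | hsl
    · have := hW δ u m h hs.2.2.2 φ hφ s l hs0 hsl
      rw [abs_of_nonneg (sub_nonneg.2 hsl)]
      linarith [(abs_le.1 this).1]
    · have := hW δ u m h hs.2.2.2 φ hφ l s hl0 hsl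
      rw [abs_sub_comm, abs_of_nonneg (sub_nonneg.2 hsl)]
      linarith [(abs_le.1 this).2]
  · have := ht' δ u m h t ht x
    linarith

/-- Lemma 1.3 of the paper.  There is a constant `C > 0`,
independent of the initial measure, of the horizon and of `δ`, bounding `‖Du‖_∞`,
`‖D²u‖`, the `1/2`-Hölder constant of `t ↦ m(t)` in the Wasserstein distance, and
`‖∂ₜu‖_∞`, for every bounded classical solution `(u,m)` of the discounted MFG system. -/
theorem uniform_estimates (d : ℕ) (S : MFGSetting d) :
    ∃ C : ℝ, 0 < C ∧ ∀ δ : ℝ, 0 < δ → ∀ (u : ℝ → Vd d → ℝ) (m : ℝ → PTd d),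
      SolvesDiscMFG S δ u m →
      (∃ M : ℝ, ∀ t ∈ Set.Ici (0:ℝ), ∀ x : Vd d, |u t x| ≤ M) →
      ((∀ t ∈ Set.Ici (0:ℝ), ∀ x : Vd d, Real.sqrt (sqnorm (gradv (u t) x)) ≤ C) ∧
       (∀ t ∈ Set.Ici (0:ℝ), ∀ x v w : Vd d, |D2 (u t) x v w| ≤ C * ‖v‖ * ‖w‖) ∧
       (∀ s ∈ Set.Ici (0:ℝ), ∀ l ∈ Set.Ici (0:ℝ), W1 (m s) (m l) ≤ C * Real.sqrt |l - s|) ∧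
       (∀ t ∈ Set.Ici (0:ℝ), ∀ x : Vd d, |tderiv u t x| ≤ C)) := by
  exact ue_final d S
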